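/- arXiv:1609.04540 — 12 statements merged into one kernel-verified Lean document; each statement's English description precedes it below -/
import Mathlib

section
/- Let L : ℂ[x] → ℂ[x] be a linear map that does not increase the degree, i.e. deg L(x^n) ≤ n for every n ≥ 0. Then there exists a unique sequence of polynomials (a_ν)_{ν≥0} with deg a_ν ≤ ν for all ν, such that L(p)(x) = Σ_{ν≥0} (a_ν(x)/ν!)·p^{(ν)}(x) for every polynomial p (the sum is finite for each p, since p^{(ν)} = 0 for ν > deg p). -/
open Polynomial

/-- The coefficients, defined recursively from the values of `L` on monomials. -/
noncomputable def expansionCoeff (L : ℂ[X] →ₗ[ℂ] ℂ[X]) (n : ℕ) : ℂ[X] :=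
  L (X ^ n) - ∑ ν : Fin n,
    (Nat.factorial ν.1 : ℂ)⁻¹ • (expansionCoeff L ν.1 * derivative^[ν.1] (X ^ n : ℂ[X]))
termination_by n
decreasing_by exact ν.2

lemma expansionCoeff_eq (L : ℂ[X] →ₗ[ℂ] ℂ[X]) (n : ℕ) :
    expansionCoeff L n = L (X ^ n) - ∑ ν ∈ Finset.range n,
      (Nat.factorial ν : ℂ)⁻¹ • (expansionCoeff L ν * derivative^[ν] (X ^ n : ℂ[X])) := by
  rw [expansionCoeff, Finset.sum_range]

lemma top_term (b : ℂ[X]) (n : ℕ) :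
    (Nat.factorial n : ℂ)⁻¹ • (b * derivative^[n] (X ^ n : ℂ[X])) = b := by
  have h : (Nat.factorial n : ℂ) ≠ 0 := by exact_mod_cast Nat.factorial_ne_zero n
  rw [iterate_derivative_X_pow_eq_smul, Nat.descFactorial_self, Nat.sub_self, pow_zero,
    mul_smul_comm, mul_one, smul_smul, inv_mul_cancel₀ h, one_smul]

lemma expansionCoeff_degree (L : ℂ[X] →ₗ[ℂ] ℂ[X])
    (hL : ∀ n : ℕ, (L (X ^ n)).degree ≤ (n : ℕ)) (n : ℕ) :
    (expansionCoeff L n).degree ≤ (n : ℕ) := by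
  induction n using Nat.strong_induction_on with
  | _ n ih =>
    rw [expansionCoeff_eq]
    refine (degree_sub_le _ _).trans (max_le (hL n) ?_)
    refine (degree_sum_le _ _).trans (Finset.sup_le fun ν hν => ?_)
    have hν' := Finset.mem_range.1 hν
    refine (degree_smul_le _ _).trans ?_
    rw [iterate_derivative_X_pow_eq_smul, mul_smul_comm]
    refine (degree_smul_le _ _).trans ((degree_mul_le _ _).trans ?_)
    rw [degree_X_pow]
    refine (add_le_add_left (ih ν hν') _).trans ?_
    rw [← Nat.cast_add, Nat.add_sub_cancel' hν'.le]

lemma extend_range (a : ℕ → ℂ[X]) (p : ℂ[X]) (N : ℕ) (h : p.natDegree < N) :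
    ∑ ν ∈ Finset.range (p.natDegree + 1),
        (Nat.factorial ν : ℂ)⁻¹ • (a ν * derivative^[ν] p) =
    ∑ ν ∈ Finset.range N, (Nat.factorial ν : ℂ)⁻¹ • (a ν * derivative^[ν] p) := by
  refine Finset.sum_subset (Finset.range_mono h) fun ν _ hν => ?_
  rw [iterate_derivative_eq_zero (by simpa [Nat.lt_succ_iff] using hν), mul_zero, smul_zero]

/-- every linear map on `ℂ[X]` not increasing the degree has a unique
expansion `L = Σ_{ν≥0} (a_ν(x)/ν!) D^ν` with `deg a_ν ≤ ν`. -/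
theorem degree_nonincreasing_unique_expansion
    (L : ℂ[X] →ₗ[ℂ] ℂ[X]) (hL : ∀ n : ℕ, (L (X ^ n)).degree ≤ (n : ℕ)) :
    ∃! a : ℕ → ℂ[X], (∀ ν : ℕ, (a ν).degree ≤ (ν : ℕ)) ∧
      ∀ p : ℂ[X], L p = ∑ ν ∈ Finset.range (p.natDegree + 1),
        (Nat.factorial ν : ℂ)⁻¹ • (a ν * derivative^[ν] p) := by
  refine ⟨expansionCoeff L, ⟨expansionCoeff_degree L hL, fun p => ?_⟩, ?_⟩
  · have hX : ∀ n N : ℕ, n < N → L (X ^ n) = ∑ ν ∈ Finset.range N,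
        (Nat.factorial ν : ℂ)⁻¹ • (expansionCoeff L ν * derivative^[ν] (X ^ n : ℂ[X])) := by
      intro n N h
      rw [← extend_range _ _ N (by simpa using h), natDegree_X_pow, Finset.sum_range_succ,
        top_term]
      rw [expansionCoeff_eq L n]
      simp
    have hp : p = ∑ i ∈ Finset.range (p.natDegree + 1), p.coeff i • (X ^ i : ℂ[X]) := by
      conv_lhs => rw [p.as_sum_range_C_mul_X_pow]
      simp only [smul_eq_C_mul]
    generalize p.natDegree + 1 = N at hp ⊢
    have hT : ∀ ν, derivative^[ν] p =
        ∑ i ∈ Finset.range N, p.coeff i • derivative^[ν] (X ^ i : ℂ[X]) := by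
      intro ν
      conv_lhs => rw [hp]
      rw [iterate_derivative_sum]
      simp only [iterate_derivative_smul]
    simp only [hT]
    conv_lhs => rw [hp]
    simp only [map_sum, map_smul, Finset.mul_sum, Finset.smul_sum]
    rw [Finset.sum_comm]
    refine Finset.sum_congr rfl fun i hi => ?_
    rw [hX i N (Finset.mem_range.1 hi), Finset.smul_sum]
    refine Finset.sum_congr rfl fun ν _ => ?_
    rw [mul_smul_comm, smul_comm]
  · rintro b ⟨-, hb⟩
    funext n
    induction n using Nat.strong_induction_on with
    | _ n ih =>
      have h := hb (X ^ n)
      rw [natDegree_X_pow, Finset.sum_range_succ, top_term] at h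
      rw [expansionCoeff_eq, h, Finset.sum_congr rfl
        (fun ν hν => by rw [ih ν (Finset.mem_range.1 hν)])]
      simp
end

section
/- Let (a_ν)_{ν≥0} be polynomials with deg a_ν ≤ ν and let J : ℂ[x] → ℂ[x] be the linear operator J(p)(x) = Σ_{ν≥0} (a_ν(x)/ν!)·p^{(ν)}(x). Then J is a linear isomorphism of ℂ[x] if and only if λ_n^{[0]} := Σ_{μ=0}^{n} C(n,μ)·a_μ^{[μ]} ≠ 0 for every n ≥ 0, where a_μ^{[μ]} denotes the coefficient of x^μ in a_μ(x) and C(n,μ) is a binomial coefficient. -/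
open Polynomial

/-- The operator `J(p) = Σ_{ν≥0} (a_ν(x)/ν!) p^{(ν)}(x)` associated with a sequence of
polynomials `(a_ν)` with `deg a_ν ≤ ν`. -/
noncomputable def Jop (a : ℕ → ℂ[X]) (p : ℂ[X]) : ℂ[X] :=
  ∑ ν ∈ Finset.range (p.natDegree + 1),
    (Nat.factorial ν : ℂ)⁻¹ • (a ν * derivative^[ν] p)

theorem Jop_eq_of_le (a : ℕ → ℂ[X]) (p : ℂ[X]) (n : ℕ) (h : p.natDegree ≤ n) :
    Jop a p = ∑ ν ∈ Finset.range (n + 1),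
      (Nat.factorial ν : ℂ)⁻¹ • (a ν * derivative^[ν] p) := by
  unfold Jop
  apply Finset.sum_subset
  · intro x hx
    simp only [Finset.mem_range] at *
    omega
  · intro x _ hx
    simp only [Finset.mem_range] at hx
    rw [iterate_derivative_eq_zero (by omega)]
    simp

theorem Jop_add (a : ℕ → ℂ[X]) (p q : ℂ[X]) : Jop a (p + q) = Jop a p + Jop a q := by
  rw [Jop_eq_of_le a (p + q) (max p.natDegree q.natDegree) (natDegree_add_le p q),
    Jop_eq_of_le a p (max p.natDegree q.natDegree) (le_max_left _ _),
    Jop_eq_of_le a q (max p.natDegree q.natDegree) (le_max_right _ _),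
    ← Finset.sum_add_distrib]
  refine Finset.sum_congr rfl fun ν _ => ?_
  rw [iterate_map_add, mul_add, smul_add]

theorem Jop_smul (a : ℕ → ℂ[X]) (c : ℂ) (p : ℂ[X]) : Jop a (c • p) = c • Jop a p := by
  rw [Jop_eq_of_le a (c • p) p.natDegree (natDegree_smul_le c p), Jop, Finset.smul_sum]
  refine Finset.sum_congr rfl fun ν _ => ?_
  rw [iterate_derivative_smul, mul_smul_comm, smul_comm]

/-- The operator as a linear map. -/
noncomputable def JopLin (a : ℕ → ℂ[X]) : ℂ[X] →ₗ[ℂ] ℂ[X] where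
  toFun := Jop a
  map_add' := Jop_add a
  map_smul' := Jop_smul a

theorem Jop_natDegree_le (a : ℕ → ℂ[X]) (ha : ∀ ν : ℕ, (a ν).degree ≤ (ν : ℕ))
    (p : ℂ[X]) (n : ℕ) (h : p.natDegree ≤ n) : (Jop a p).natDegree ≤ n := by
  rw [Jop_eq_of_le a p n h]
  refine natDegree_sum_le_of_forall_le _ _ fun ν hν => ?_
  simp only [Finset.mem_range] at hν
  refine (natDegree_smul_le _ _).trans (natDegree_mul_le.trans ?_)
  have h1 := natDegree_le_of_degree_le (ha ν)
  have h2 := natDegree_iterate_derivative p ν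
  omega

theorem Jop_coeff (a : ℕ → ℂ[X]) (ha : ∀ ν : ℕ, (a ν).degree ≤ (ν : ℕ))
    (p : ℂ[X]) (n : ℕ) (h : p.natDegree ≤ n) : (Jop a p).coeff n =
      (∑ μ ∈ Finset.range (n + 1), (n.choose μ : ℂ) * (a μ).coeff μ) * p.coeff n := by
  rw [Jop_eq_of_le a p n h, finsetSum_coeff, Finset.sum_mul]
  refine Finset.sum_congr rfl fun ν hν => ?_
  simp only [Finset.mem_range] at hν
  obtain ⟨k, rfl⟩ : ∃ k, n = ν + k := ⟨n - ν, by omega⟩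
  have h1 := natDegree_le_of_degree_le (ha ν)
  have h2 := natDegree_iterate_derivative p ν
  rw [coeff_smul, coeff_mul_add_eq_of_natDegree_le h1 (show _ ≤ k by omega),
    coeff_iterate_derivative, Nat.add_comm k ν, Nat.descFactorial_eq_factorial_mul_choose]
  have h3 : (Nat.factorial ν : ℂ) ≠ 0 := by exact_mod_cast Nat.factorial_ne_zero ν
  simp only [smul_eq_mul, nsmul_eq_mul, Nat.cast_mul]
  field_simp

theorem Jop_surj_aux (a : ℕ → ℂ[X]) (ha : ∀ ν : ℕ, (a ν).degree ≤ (ν : ℕ))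
    (hl : ∀ n : ℕ, (∑ μ ∈ Finset.range (n + 1), (n.choose μ : ℂ) * (a μ).coeff μ) ≠ 0)
    (n : ℕ) : ∀ q : ℂ[X], q.degree < n → ∃ p, JopLin a p = q := by
  induction n with
  | zero =>
    intro q hq
    refine ⟨0, ?_⟩
    rw [map_zero]
    ext k
    rw [coeff_zero, (degree_lt_iff_coeff_zero q 0).1 hq k (Nat.zero_le k)]
  | succ n ih =>
    intro q hq
    set c := (∑ μ ∈ Finset.range (n + 1), (n.choose μ : ℂ) * (a μ).coeff μ) with hc
    have hm : (monomial n (q.coeff n / c)).natDegree ≤ n := natDegree_monomial_le _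
    obtain ⟨p, hp⟩ := ih (q - JopLin a (monomial n (q.coeff n / c))) (by
      rw [degree_lt_iff_coeff_zero]
      intro k hk
      rw [coeff_sub]
      change _ - (Jop a _).coeff k = 0
      rcases hk.eq_or_lt with rfl | hk
      · rw [Jop_coeff a ha _ _ hm, coeff_monomial_same, ← hc, mul_div_cancel₀ _ (hl n), sub_self]
      · rw [(degree_lt_iff_coeff_zero q _).1 hq k hk,
          coeff_eq_zero_of_natDegree_lt ((Jop_natDegree_le a ha _ n hm).trans_lt hk), sub_self])
    exact ⟨p + monomial n (q.coeff n / c), by rw [map_add, hp, sub_add_cancel]⟩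

/-- `J` is an isomorphism of `ℂ[X]` iff
`λ_n^{[0]} = Σ_{μ=0}^n C(n,μ) a_μ^{[μ]} ≠ 0` for all `n`. -/
theorem Jop_bijective_iff
    (a : ℕ → ℂ[X]) (ha : ∀ ν : ℕ, (a ν).degree ≤ (ν : ℕ)) :
    Function.Bijective (Jop a) ↔
      ∀ n : ℕ, (∑ μ ∈ Finset.range (n + 1), (n.choose μ : ℂ) * (a μ).coeff μ) ≠ 0 := by
  constructor
  · rintro ⟨hinj, -⟩ n hn
    have hmap : ∀ p ∈ degreeLT ℂ (n + 1), JopLin a p ∈ degreeLT ℂ n := by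
      intro p hp
      rw [mem_degreeLT] at hp
      have hp' : p.natDegree ≤ n := by
        rw [natDegree_le_iff_coeff_eq_zero]
        intro k hk
        exact (degree_lt_iff_coeff_zero p _).1 hp k hk
      rw [mem_degreeLT, degree_lt_iff_coeff_zero]
      intro k hk
      change (Jop a p).coeff k = 0
      rcases hk.eq_or_lt with rfl | hk
      · rw [Jop_coeff a ha p _ hp', hn, zero_mul]
      · exact coeff_eq_zero_of_natDegree_lt ((Jop_natDegree_le a ha p n hp').trans_lt hk)
    have hinj' : Function.Injective ((JopLin a).restrict hmap) := by
      intro x y hxy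
      exact Subtype.ext (hinj (congrArg Subtype.val hxy))
    have hcomp : Function.Injective (((degreeLTEquiv ℂ n).toLinearMap ∘ₗ
        ((JopLin a).restrict hmap)) ∘ₗ (degreeLTEquiv ℂ (n + 1)).symm.toLinearMap) :=
      (degreeLTEquiv ℂ n).injective.comp (hinj'.comp (degreeLTEquiv ℂ (n + 1)).symm.injective)
    have hfin := LinearMap.finrank_le_finrank_of_injective hcomp
    simp at hfin
  · intro hl
    constructor
    · change Function.Injective (JopLin a)
      rw [injective_iff_map_eq_zero]
      intro p hp
      have h := Jop_coeff a ha p p.natDegree le_rfl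
      change Jop a p = 0 at hp
      rw [hp, coeff_zero] at h
      rcases mul_eq_zero.1 h.symm with h | h
      · exact absurd h (hl _)
      · exact leadingCoeff_eq_zero.1 h
    · intro q
      exact Jop_surj_aux a ha hl (q.natDegree + 1) q
        (degree_le_natDegree.trans_lt (by exact_mod_cast Nat.lt_succ_self _))
end

section
/- Let (a_ν)_{ν≥0} be polynomials with deg a_ν ≤ ν, let J(p)(x) = Σ_{ν≥0} (a_ν(x)/ν!)·p^{(ν)}(x), and for m ≥ 0 define J^{(m)}(p)(x) = Σ_{n≥0} (a_{n+m}(x)/n!)·p^{(n)}(x). Then for all polynomials f, g: J(fg)(x) = Σ_{n≥0} J^{(n)}(f)(x)·g^{(n)}(x)/n! = Σ_{n≥0} J^{(n)}(g)(x)·f^{(n)}(x)/n! (all sums finite). -/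
open Polynomial

/-- The shifted operator `J^{(m)}(p) = Σ_{n≥0} (a_{n+m}(x)/n!) p^{(n)}(x)`. -/
noncomputable def Jshift (a : ℕ → ℂ[X]) (m : ℕ) : ℂ[X] → ℂ[X] :=
  Jop (fun n => a (n + m))

theorem inv_fact_smul_iter (n : ℕ) (p : ℂ[X]) :
    (Nat.factorial n : ℂ)⁻¹ • (derivative^[n] p) = hasseDeriv n p := by
  have h := congrFun (factorial_smul_hasseDeriv (R := ℂ) n) p
  rw [← h, LinearMap.smul_apply, ← Nat.cast_smul_eq_nsmul ℂ, smul_smul,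
    inv_mul_cancel₀ (by exact_mod_cast Nat.factorial_ne_zero n), one_smul]

theorem Jop_eq (a : ℕ → ℂ[X]) (p : ℂ[X]) (N : ℕ) (hN : p.natDegree < N) :
    Jop a p = ∑ n ∈ Finset.range N, a n * hasseDeriv n p := by
  unfold Jop
  simp only [← mul_smul_comm, inv_fact_smul_iter]
  refine Finset.sum_subset (Finset.range_subset_range.2 hN) ?_
  intro n _ hn
  rw [hasseDeriv_eq_zero_of_lt_natDegree p n (by simpa [Nat.lt_succ_iff] using hn), mul_zero]

theorem Jop_mul_aux (a : ℕ → ℂ[X]) (f g : ℂ[X]) :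
    Jop a (f * g) = (∑ n ∈ Finset.range (g.natDegree + 1),
        (Nat.factorial n : ℂ)⁻¹ • (Jshift a n f * derivative^[n] g)) := by
  rw [Jop_eq a (f * g) (f.natDegree + g.natDegree + 1) (Nat.lt_succ_of_le natDegree_mul_le)]
  simp only [← mul_smul_comm, inv_fact_smul_iter, Jshift]
  have h1 : ∀ n, Jop (fun k => a (k + n)) f * hasseDeriv n g =
      ∑ m ∈ Finset.range (f.natDegree + 1),
        a (m + n) * (hasseDeriv m f * hasseDeriv n g) := by
    intro n
    rw [Jop_eq _ f _ (Nat.lt_succ_self _), Finset.sum_mul]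
    simp only [mul_assoc]
  simp only [h1]
  rw [Finset.sum_comm, ← Finset.sum_product',
    ← Finset.sum_fiberwise_of_maps_to (t := Finset.range (f.natDegree + g.natDegree + 1))
      (g := fun x : ℕ × ℕ => x.1 + x.2)
      (by intro x hx; simp only [Finset.mem_product, Finset.mem_range] at hx ⊢; omega)]
  refine Finset.sum_congr rfl fun k _ => ?_
  rw [hasseDeriv_mul, Finset.mul_sum]
  symm
  have h2 : ∀ x ∈ Finset.HasAntidiagonal.antidiagonal k, a k * (hasseDeriv x.1 f * hasseDeriv x.2 g) =
      a (x.1 + x.2) * (hasseDeriv x.1 f * hasseDeriv x.2 g) := by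
    intro x hx
    rw [Finset.HasAntidiagonal.mem_antidiagonal.1 hx]
  rw [Finset.sum_congr rfl h2]
  refine Finset.sum_subset ?_ ?_
  · intro x hx
    exact Finset.HasAntidiagonal.mem_antidiagonal.2 (Finset.mem_filter.1 hx).2
  · intro x hx hx'
    rw [Finset.HasAntidiagonal.mem_antidiagonal] at hx
    simp only [Finset.mem_filter, Finset.mem_product, Finset.mem_range, hx, and_true] at hx'
    by_cases hf : f.natDegree < x.1
    · rw [hasseDeriv_eq_zero_of_lt_natDegree f _ hf, zero_mul, mul_zero]
    · rw [hasseDeriv_eq_zero_of_lt_natDegree g x.2 (by omega), mul_zero, mul_zero]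

/-- `J(fg) = Σ_{n≥0} J^{(n)}(f)·g^{(n)}/n! = Σ_{n≥0} J^{(n)}(g)·f^{(n)}/n!`. -/
theorem Jop_mul (a : ℕ → ℂ[X]) (ha : ∀ ν : ℕ, (a ν).degree ≤ (ν : ℕ)) (f g : ℂ[X]) :
    Jop a (f * g) = (∑ n ∈ Finset.range (g.natDegree + 1),
        (Nat.factorial n : ℂ)⁻¹ • (Jshift a n f * derivative^[n] g)) ∧
    Jop a (f * g) = (∑ n ∈ Finset.range (f.natDegree + 1),
        (Nat.factorial n : ℂ)⁻¹ • (Jshift a n g * derivative^[n] f)) := by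
  exact ⟨Jop_mul_aux a f g, by rw [mul_comm]; exact Jop_mul_aux a g f⟩
end

section
/- Let (a_ν)_{ν≥0} be polynomials with deg a_ν ≤ ν and J(p)(x) = Σ_{ν≥0} (a_ν(x)/ν!)·p^{(ν)}(x). For m ≥ 0 let J^{(m)} act on a linear functional u by J^{(m)}(u) = Σ_{n≥0} ((−1)^n/n!)·D^n(a_{n+m} u), and let J act on functionals by its transpose J(u) = J^{(0)}(u). Then for every polynomial f and every linear functional u: J(fu) = Σ_{n≥0} ((−1)^n/n!)·f^{(n)}·J^{(n)}(u), meaning that both sides agree as linear functionals on every polynomial (all sums being finite on each test polynomial). -/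
open Polynomial

/-- Left multiplication of a linear functional by a polynomial: `⟨fu,p⟩ = ⟨u,fp⟩`. -/
noncomputable def lmulD (f : ℂ[X]) (u : Module.Dual ℂ ℂ[X]) : Module.Dual ℂ ℂ[X] :=
  u ∘ₗ LinearMap.mulLeft ℂ f

/-- Derivative of a linear functional: `⟨Du,p⟩ = −⟨u,p'⟩`. -/
noncomputable def derD (u : Module.Dual ℂ ℂ[X]) : Module.Dual ℂ ℂ[X] :=
  - (u ∘ₗ (derivative : ℂ[X] →ₗ[ℂ] ℂ[X]))

/-- The action of `J^{(m)}(u) = Σ_{j≥0} ((−1)^j/j!) D^j(a_{j+m} u)` on a test polynomial `q`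
(a finite sum on each test polynomial). -/
noncomputable def JshiftDualApply (a : ℕ → ℂ[X]) (m : ℕ) (u : Module.Dual ℂ ℂ[X])
    (q : ℂ[X]) : ℂ :=
  ∑ j ∈ Finset.range (q.natDegree + 1),
    ((-1 : ℂ) ^ j / (Nat.factorial j : ℂ)) * (derD^[j] (lmulD (a (j + m)) u)) q

lemma derD_iterate_apply (j : ℕ) (v : Module.Dual ℂ ℂ[X]) (q : ℂ[X]) :
    (derD^[j] v) q = (-1 : ℂ) ^ j * v (derivative^[j] q) := by
  induction j generalizing v with
  | zero => simp
  | succ j ih =>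
    rw [Function.iterate_succ_apply, ih, Function.iterate_succ_apply']
    simp [derD, pow_succ]

lemma leibniz_inv (k : ℕ) (f p : ℂ[X]) :
    f * derivative^[k] p = ∑ n ∈ Finset.range (k + 1),
      ((-1 : ℂ) ^ n * (k.choose n : ℂ)) • derivative^[k - n] (derivative^[n] f * p) := by
  let D : Module.End ℂ ℂ[X] := derivative
  let L : Module.End ℂ (Module.End ℂ ℂ[X]) := LinearMap.mulLeft ℂ D
  let R : Module.End ℂ (Module.End ℂ ℂ[X]) := -LinearMap.mulRight ℂ D
  have hc : Commute R L := by
    refine LinearMap.ext fun x => ?_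
    refine LinearMap.ext fun y => ?_
    simp [L, R, D, Module.End.mul_apply]
  have h1 : ∀ k : ℕ, ((R + L) ^ k) (LinearMap.mulRight ℂ p)
      = LinearMap.mulRight ℂ (derivative^[k] p) := by
    intro k
    induction k with
    | zero => simp
    | succ k ih =>
      rw [pow_succ', Module.End.mul_apply, ih, Function.iterate_succ_apply']
      refine LinearMap.ext fun x => ?_
      simp [L, R, D]
  have hR : ∀ (n : ℕ) (φ : Module.End ℂ ℂ[X]), (R ^ n) φ = (-1 : ℂ) ^ n • (φ * D ^ n) := by
    intro n
    induction n with
    | zero => simp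
    | succ n ih =>
      intro φ
      rw [pow_succ, Module.End.mul_apply, ih]
      refine LinearMap.ext fun y => ?_
      simp [R, pow_succ' D, pow_succ (-1 : ℂ), Module.End.mul_apply]
  have hL : ∀ (n : ℕ) (φ : Module.End ℂ ℂ[X]), (L ^ n) φ = D ^ n * φ := by
    intro n φ
    simp [L, LinearMap.pow_mulLeft]
  have h2 := congrArg (fun φ : Module.End ℂ ℂ[X] => φ f) (h1 k)
  simp only [LinearMap.mulRight_apply] at h2
  rw [← h2, hc.add_pow, LinearMap.sum_apply, LinearMap.sum_apply]
  refine Finset.sum_congr rfl fun n _ => ?_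
  rw [← nsmul_eq_mul', LinearMap.smul_apply, Module.End.mul_apply, hL, hR]
  simp only [LinearMap.smul_apply, Module.End.mul_apply, Module.End.pow_apply,
    LinearMap.mulRight_apply]
  rw [← Nat.cast_smul_eq_nsmul ℂ, smul_smul, mul_comm]

theorem Jop_lmul_dual
    (a : ℕ → ℂ[X]) (ha : ∀ ν : ℕ, (a ν).degree ≤ (ν : ℕ))
    (f : ℂ[X]) (u : Module.Dual ℂ ℂ[X]) (p : ℂ[X]) :
    u (f * Jop a p) = ∑ n ∈ Finset.range (f.natDegree + 1),
      ((-1 : ℂ) ^ n / (Nat.factorial n : ℂ)) *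
        JshiftDualApply a n u (derivative^[n] f * p) := by
  let N := f.natDegree + p.natDegree + 1
  let F : ℕ → ℕ → ℂ := fun n j => ((-1 : ℂ) ^ n / (n.factorial : ℂ)) *
    ((j.factorial : ℂ)⁻¹ * u (a (j + n) * derivative^[j] (derivative^[n] f * p)))
  have hR : ∑ n ∈ Finset.range (f.natDegree + 1), ((-1 : ℂ) ^ n / (Nat.factorial n : ℂ)) *
        JshiftDualApply a n u (derivative^[n] f * p)
      = ∑ n ∈ Finset.range N, ∑ j ∈ Finset.range (N - n), F n j := by
    have e : ∑ n ∈ Finset.range (f.natDegree + 1), ∑ j ∈ Finset.range (N - n), F n j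
        = ∑ n ∈ Finset.range N, ∑ j ∈ Finset.range (N - n), F n j := by
      refine Finset.sum_subset (Finset.range_subset_range.2 (by omega)) fun n _ hn => ?_
      refine Finset.sum_eq_zero fun j _ => ?_
      have : derivative^[n] f = 0 :=
        iterate_derivative_eq_zero (by have := mt Finset.mem_range.2 hn; omega)
      simp [F, this]
    rw [← e]
    refine Finset.sum_congr rfl fun n hn => ?_
    have hn' : n ≤ f.natDegree := by simpa [Nat.lt_succ_iff] using hn
    have hd : (derivative^[n] f * p).natDegree ≤ f.natDegree - n + p.natDegree :=
      natDegree_mul_le.trans (Nat.add_le_add_right (natDegree_iterate_derivative f n) _)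
    rw [JshiftDualApply, Finset.mul_sum]
    have e2 : ∑ j ∈ Finset.range ((derivative^[n] f * p).natDegree + 1), F n j
        = ∑ j ∈ Finset.range (N - n), F n j := by
      refine Finset.sum_subset (Finset.range_subset_range.2 (by omega)) fun j _ hj => ?_
      have : derivative^[j] (derivative^[n] f * p) = 0 :=
        iterate_derivative_eq_zero (by have := mt Finset.mem_range.2 hj; omega)
      simp [F, this]
    rw [← e2]
    refine Finset.sum_congr rfl fun j _ => ?_
    have hs : (-1 : ℂ) ^ j * (-1 : ℂ) ^ j = 1 := by rw [← mul_pow]; simp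
    rw [derD_iterate_apply]
    simp only [F, lmulD, LinearMap.comp_apply, LinearMap.mulLeft_apply]
    congr 1
    rw [div_eq_mul_inv, mul_mul_mul_comm, mul_comm ((-1 : ℂ) ^ j) _, mul_assoc]
    linear_combination ((j.factorial : ℂ)⁻¹ *
      u (a (j + n) * derivative^[j] (derivative^[n] f * p))) * hs
  have hL : u (f * Jop a p) = ∑ k ∈ Finset.range N,
      (k.factorial : ℂ)⁻¹ * u (a k * (f * derivative^[k] p)) := by
    rw [Jop, Finset.mul_sum, map_sum]
    have e : ∑ k ∈ Finset.range (p.natDegree + 1),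
          (k.factorial : ℂ)⁻¹ * u (a k * (f * derivative^[k] p))
        = ∑ k ∈ Finset.range N, (k.factorial : ℂ)⁻¹ * u (a k * (f * derivative^[k] p)) := by
      refine Finset.sum_subset (Finset.range_subset_range.2 (by omega)) fun k _ hk => ?_
      have : derivative^[k] p = 0 :=
        iterate_derivative_eq_zero (by have := mt Finset.mem_range.2 hk; omega)
      simp [this]
    rw [← e]
    refine Finset.sum_congr rfl fun k _ => ?_
    rw [mul_smul_comm, map_smul, smul_eq_mul, mul_left_comm f]
  rw [hR, hL, ← Finset.sum_range_diag_flip]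
  refine Finset.sum_congr rfl fun k _ => ?_
  rw [leibniz_inv, Finset.mul_sum, map_sum, Finset.mul_sum]
  refine Finset.sum_congr rfl fun n hn => ?_
  have hn' : n ≤ k := by simpa [Nat.lt_succ_iff] using hn
  simp only [F]
  rw [Nat.sub_add_cancel hn', mul_smul_comm, map_smul, smul_eq_mul, Nat.cast_choose ℂ hn']
  have h1 : (k.factorial : ℂ) ≠ 0 := by exact_mod_cast k.factorial_ne_zero
  have h2 : (n.factorial : ℂ) ≠ 0 := by exact_mod_cast n.factorial_ne_zero
  have h3 : ((k - n).factorial : ℂ) ≠ 0 := by exact_mod_cast (k - n).factorial_ne_zero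
  field_simp
end

section
/- Let k ≥ 0 be an integer and let J be a lowering operator of order k with coefficient polynomials (a_ν) and constants λ_{n+k}^{[k]}. Let (P_n)_{n≥0} be a monic polynomial sequence with dual sequence (u_n)_{n≥0}, define the monic polynomial sequence P̃_n(x) = (λ_{n+k}^{[k]})^{-1}·J(P_{n+k})(x) for n ≥ 0, and let (ũ_n)_{n≥0} be the dual sequence of (P̃_n). Then for every n ≥ 0, ^tJ(ũ_n) = λ_{n+k}^{[k]}·u_{n+k}, where ^tJ is the transpose of J on linear functionals, ⟨^tJ(u), p⟩ = ⟨u, J(p)⟩. -/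
open Polynomial

/-- The constants `λ_{n+k}^{[k]} = Σ_{ν=0}^n C(n+k, n+k−ν)·a_{n−ν}^{[n+k−ν]}`. -/
noncomputable def lamJ (k : ℕ) (a : ℕ → ℂ[X]) (n : ℕ) : ℂ :=
  ∑ ν ∈ Finset.range (n + 1),
    ((n + k).choose (n + k - ν) : ℂ) * (a (n + k - ν)).coeff (n - ν)

lemma Jop_eq_of_lt (a : ℕ → ℂ[X]) (p : ℂ[X]) (N : ℕ) (h : p.natDegree < N) :
    Jop a p = ∑ ν ∈ Finset.range N, (Nat.factorial ν : ℂ)⁻¹ • (a ν * derivative^[ν] p) := by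
  unfold Jop
  apply Finset.sum_subset
  · intro x hx
    simp only [Finset.mem_range] at *
    omega
  · intro x _ hx
    simp only [Finset.mem_range] at hx
    rw [iterate_derivative_eq_zero (by omega)]
    simp

lemma Jop_add_smul (a : ℕ → ℂ[X]) (c : ℂ) (p q : ℂ[X]) :
    Jop a (c • p + q) = c • Jop a p + Jop a q := by
  have h := natDegree_add_le (c • p) q
  have h2 := natDegree_smul_le c p
  have h3 : (c • p + q).natDegree < p.natDegree + q.natDegree + 1 := by
    have := max_le_iff.1 (le_refl (max (c • p).natDegree q.natDegree))
    rcases max_choice (c • p).natDegree q.natDegree with h4 | h4 <;> omega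
  rw [Jop_eq_of_lt a _ _ h3, Jop_eq_of_lt a p (p.natDegree + q.natDegree + 1) (by omega),
    Jop_eq_of_lt a q (p.natDegree + q.natDegree + 1) (by omega), Finset.smul_sum,
    ← Finset.sum_add_distrib]
  refine Finset.sum_congr rfl fun ν _ => ?_
  rw [iterate_map_add, iterate_derivative_smul, mul_add, smul_add, mul_smul_comm,
    smul_comm]

/-- if `J` is a lowering operator of order `k`, `(P_n)` is a MPS with dual
sequence `(u_n)`, `P̃_n = (λ_{n+k}^{[k]})⁻¹ J(P_{n+k})` with dual sequence `(ũ_n)`, then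
`^tJ(ũ_n) = λ_{n+k}^{[k]}·u_{n+k}`, i.e. `⟨ũ_n, J(p)⟩ = λ_{n+k}^{[k]}·⟨u_{n+k}, p⟩`. -/
theorem transpose_J_dual_of_Jimage
    (k : ℕ) (a : ℕ → ℂ[X])
    (ha0 : ∀ ν : ℕ, ν < k → a ν = 0)
    (ha1 : ∀ ν : ℕ, k ≤ ν → (a ν).degree ≤ ((ν - k : ℕ) : WithBot ℕ))
    (hlam : ∀ n : ℕ, lamJ k a n ≠ 0)
    (P : ℕ → ℂ[X]) (hPmonic : ∀ n, (P n).Monic) (hPdeg : ∀ n, (P n).natDegree = n)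
    (u : ℕ → Module.Dual ℂ ℂ[X])
    (hu : ∀ n m : ℕ, u n (P m) = if n = m then 1 else 0)
    (Pt : ℕ → ℂ[X]) (hPt : ∀ n : ℕ, Pt n = (lamJ k a n)⁻¹ • Jop a (P (n + k)))
    (ut : ℕ → Module.Dual ℂ ℂ[X])
    (hut : ∀ n m : ℕ, ut n (Pt m) = if n = m then 1 else 0) :
    ∀ (n : ℕ) (p : ℂ[X]), ut n (Jop a p) = lamJ k a n * u (n + k) p := by
  intro n
  have hP : ∀ m, ut n (Jop a (P m)) = lamJ k a n * u (n + k) (P m) := by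
    intro m
    rw [hu]
    by_cases hm : m < k
    · have h0 : Jop a (P m) = 0 := by
        unfold Jop
        refine Finset.sum_eq_zero fun ν hν => ?_
        rw [hPdeg, Finset.mem_range] at hν
        rw [ha0 ν (by omega)]
        simp
      rw [h0, if_neg (by omega)]
      simp
    · obtain ⟨j, rfl⟩ : ∃ j, m = j + k := ⟨m - k, by omega⟩
      have h1 : Jop a (P (j + k)) = lamJ k a j • Pt j := by
        rw [hPt, smul_smul, mul_inv_cancel₀ (hlam j), one_smul]
      rw [h1, map_smul, hut]
      by_cases hnj : n = j
      · subst hnj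
        simp
      · rw [if_neg hnj, if_neg (by omega)]
        simp
  have key : ∀ N : ℕ, ∀ p : ℂ[X], p.degree < (N : WithBot ℕ) →
      ut n (Jop a p) = lamJ k a n * u (n + k) p := by
    intro N
    induction N with
    | zero =>
      intro p hp
      have : p = 0 := by simpa using hp
      subst this
      simp [Jop]
    | succ N ih =>
      intro p hp
      have hq : (p - p.coeff N • P N).degree < (N : WithBot ℕ) := by
        rw [degree_lt_iff_coeff_zero]
        intro m hm
        rw [coeff_sub, coeff_smul, smul_eq_mul]
        rcases hm.eq_or_lt with rfl | hm
        · have h1 : (P N).coeff N = 1 := by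
            have := (hPmonic N).coeff_natDegree
            rwa [hPdeg] at this
          rw [h1]
          ring
        · rw [(degree_lt_iff_coeff_zero p (N + 1)).1 (by exact_mod_cast hp) m hm,
            coeff_eq_zero_of_natDegree_lt (p := P N) (by rw [hPdeg]; exact hm)]
          simp
      have h := ih _ hq
      have e : p = p.coeff N • P N + (p - p.coeff N • P N) := by ring
      rw [e, Jop_add_smul, map_add, map_add, map_smul, map_smul, h, hP, smul_eq_mul, smul_eq_mul]
      ring
  intro p
  refine key (p.natDegree + 1) p ?_
  exact lt_of_le_of_lt degree_le_natDegree (by exact_mod_cast Nat.lt_succ_self _)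
end

section
/- Let a_0, a_1, a_2 be polynomials with deg a_ν ≤ ν (ν = 0,1,2), a_2 not identically zero, and let J = a_0(x)I + a_1(x)D + (a_2(x)/2)D², i.e. J(p) = a_0·p + a_1·p' + (a_2/2)·p''. Assume λ_n^{[0]} := a_0^{[0]} + n·a_1^{[1]} + (n(n−1)/2)·a_2^{[2]} ≠ 0 for all n ≥ 0. Let (P_n)_{n≥0} be a monic orthogonal polynomial sequence with respect to the functional u_0, with recurrence coefficients (β_n), (γ_{n+1}), and suppose J(P_n) = λ_n^{[0]}·P_n for every n ≥ 0. Then: (i) a_1^{[1]} ≠ 0; (ii) β_0 = −a_0^{[1]}/a_1^{[1]}; (iii) u_0 satisfies the classical functional equation D(a_2·u_0) + (−2a_1^{[1]}x + a_1^{[1]}β_0 − a_0^{[1]})·u_0 = 0. -/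
open Polynomial

/-- for `J = a_0 I + a_1 D + (a_2/2)D²` an isomorphism and a MOPS `(P_n)`
w.r.t. `u_0` with `J(P_n) = λ_n^{[0]} P_n`, one has `a_1^{[1]} ≠ 0`,
`β_0 = −a_0^{[1]}/a_1^{[1]}` and
`D(a_2 u_0) + (−2a_1^{[1]}x + a_1^{[1]}β_0 − a_0^{[1]})u_0 = 0`. -/
theorem isomorphism_case_classical
    (a0 a1 a2 : ℂ[X])
    (h0 : a0.degree ≤ 0) (h1 : a1.degree ≤ 1) (h2 : a2.degree ≤ 2) (ha2 : a2 ≠ 0)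
    (hlam : ∀ n : ℕ,
      a0.coeff 0 + (n : ℂ) * a1.coeff 1 + ((n : ℂ) * ((n : ℂ) - 1) / 2) * a2.coeff 2 ≠ 0)
    (β γ : ℕ → ℂ) (P : ℕ → ℂ[X])
    (hP0 : P 0 = 1) (hP1 : P 1 = X - C (β 0))
    (hPrec : ∀ n : ℕ, P (n + 2) = (X - C (β (n + 1))) * P (n + 1) - C (γ (n + 1)) * P n)
    (hγ : ∀ n : ℕ, γ (n + 1) ≠ 0)
    (u : ℕ → Module.Dual ℂ ℂ[X])
    (hu : ∀ n m : ℕ, u n (P m) = if n = m then 1 else 0)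
    (hJ : ∀ n : ℕ,
      a0 * P n + a1 * derivative (P n) + (2 : ℂ)⁻¹ • (a2 * derivative (derivative (P n))) =
        (a0.coeff 0 + (n : ℂ) * a1.coeff 1 + ((n : ℂ) * ((n : ℂ) - 1) / 2) * a2.coeff 2) • P n) :
    a1.coeff 1 ≠ 0 ∧
    β 0 = -(a1.coeff 0) / a1.coeff 1 ∧
    derD (lmulD a2 (u 0)) +
      lmulD (C (-2 * a1.coeff 1) * X + C (a1.coeff 1 * β 0 - a1.coeff 0)) (u 0) = 0 := by
  have hmon : ∀ n : ℕ, ((P n).Monic ∧ (P n).natDegree = n) ∧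
      ((P (n+1)).Monic ∧ (P (n+1)).natDegree = n + 1) := by
    intro n
    induction n with
    | zero =>
      refine ⟨⟨by rw [hP0]; exact monic_one, by rw [hP0]; exact natDegree_one⟩, ?_⟩
      rw [zero_add, hP1]
      exact ⟨monic_X_sub_C _, natDegree_X_sub_C _⟩
    | succ n ih =>
      obtain ⟨⟨m0, d0⟩, ⟨m1, d1⟩⟩ := ih
      refine ⟨⟨m1, d1⟩, ?_⟩
      rw [show n + 1 + 1 = n + 2 from rfl, hPrec]
      have mm : ((X - C (β (n + 1))) * P (n + 1)).Monic := (monic_X_sub_C _).mul m1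
      have md : ((X - C (β (n + 1))) * P (n + 1)).natDegree = n + 2 := by
        rw [(monic_X_sub_C _).natDegree_mul m1, natDegree_X_sub_C, d1]; ring
      have hlt : (C (γ (n + 1)) * P n).natDegree < ((X - C (β (n + 1))) * P (n + 1)).natDegree := by
        have := natDegree_C_mul_le (γ (n + 1)) (P n)
        omega
      refine ⟨mm.sub_of_left (degree_lt_degree hlt), ?_⟩
      rw [natDegree_sub_eq_left_of_natDegree_lt hlt, md]
  have hdeg : ∀ n, (P n).degree = n := fun n => by
    rw [degree_eq_natDegree (hmon n).1.1.ne_zero, (hmon n).1.2]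
  have ha0 : a0 = C (a0.coeff 0) := eq_C_of_degree_le_zero h0
  have ha1 : a1 = C (a1.coeff 1) * X + C (a1.coeff 0) := eq_X_add_C_of_degree_le_one h1
  have hL : ∀ n : ℕ, a1 * derivative (P n) + (2 : ℂ)⁻¹ • (a2 * derivative (derivative (P n))) =
      ((n : ℂ) * a1.coeff 1 + ((n : ℂ) * ((n : ℂ) - 1) / 2) * a2.coeff 2) • P n := by
    intro n
    have h := hJ n
    have e : a0 * P n = (a0.coeff 0) • P n := by
      conv_lhs => rw [ha0]
      rw [smul_eq_C_mul]
    rw [e, add_assoc (a0.coeff 0), add_smul, add_assoc] at h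
    exact add_left_cancel h
  have hb1 : a1 = C (a1.coeff 1) * (X - C (β 0)) := by
    have h := hL 1
    simp only [hP1, smul_eq_C_mul] at h
    simpa using h
  have hc0 : a1.coeff 0 = - (a1.coeff 1 * β 0) := by
    have := congrArg (fun p => coeff p 0) hb1
    simpa using this
  have hb : a1.coeff 1 ≠ 0 := by
    intro hb
    have hz : a1 = 0 := by rw [hb1, hb]; simp
    have hQ : ∀ n : ℕ, a2 * derivative (derivative (P n)) =
        C ((n : ℂ) * ((n : ℂ) - 1) * a2.coeff 2) * P n := by
      intro n
      have h := congrArg (fun p => (2 : ℂ) • p) (hL n)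
      simp only [hz, zero_mul, zero_add, coeff_zero, mul_zero, smul_smul] at h
      rw [mul_inv_cancel₀ two_ne_zero, one_smul] at h
      rw [h, smul_eq_C_mul]
      congr 2
      ring
    have hP2 : derivative (derivative (P 2)) = C 2 := by
      rw [hPrec 0, zero_add, hP1, hP0]
      simp
      norm_num
      exact (map_ofNat C 2).symm
    have h2' : a2 = C (a2.coeff 2) * P 2 := by
      have h := hQ 2
      rw [hP2] at h
      have h2C : (C (2 : ℂ) : ℂ[X]) ≠ 0 := C_ne_zero.2 two_ne_zero
      apply mul_left_cancel₀ h2C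
      rw [← mul_assoc, ← C_mul, mul_comm, h]
      congr 2
      push_cast
      ring
    have hc : a2.coeff 2 ≠ 0 := by
      intro hc
      apply ha2
      rw [h2', hc]; simp
    have hdvd : P 2 ∣ P 3 := by
      have h := hQ 3
      have : P 2 ∣ C (((3 : ℕ) : ℂ) * (((3 : ℕ) : ℂ) - 1) * a2.coeff 2) * P 3 := by
        rw [← h]
        apply Dvd.dvd.mul_right
        exact ⟨C (a2.coeff 2), by rw [mul_comm]; exact h2'⟩
      refine (IsUnit.dvd_mul_left ?_).1 this
      rw [isUnit_C, isUnit_iff_ne_zero]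
      refine mul_ne_zero (by norm_num) hc
    have hd1 : P 2 ∣ C (γ 2) * P 1 := by
      have h : C (γ 2) * P 1 = (X - C (β 2)) * P 2 - P 3 := by
        rw [hPrec 1]; ring
      rw [h]
      exact dvd_sub (dvd_mul_left _ _) hdvd
    have hd2 : P 2 ∣ P 1 := by
      refine (IsUnit.dvd_mul_left ?_).1 hd1
      rw [isUnit_C, isUnit_iff_ne_zero]
      exact hγ 1
    have := natDegree_le_of_dvd hd2 (hmon 1).1.1.ne_zero
    rw [(hmon 1).1.2, (hmon 2).1.2] at this
    omega
  refine ⟨hb, by rw [hc0]; field_simp, ?_⟩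
  let L : ℂ[X] →ₗ[ℂ] ℂ[X] := LinearMap.mulLeft ℂ a1 ∘ₗ derivative +
    (2 : ℂ)⁻¹ • (LinearMap.mulLeft ℂ a2 ∘ₗ derivative ∘ₗ derivative)
  let S : Polynomial.Sequence ℂ := ⟨P, hdeg⟩
  have hspan : Submodule.span ℂ (Set.range P) = ⊤ :=
    S.span (fun i => by
      have : (P i).leadingCoeff = 1 := (hmon i).1.1
      change IsUnit (P i).leadingCoeff
      rw [this]; exact isUnit_one)
  have huL : u 0 ∘ₗ L = 0 := by
    refine LinearMap.ext_on_range hspan fun n => ?_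
    change u 0 (a1 * derivative (P n) + (2 : ℂ)⁻¹ • (a2 * derivative (derivative (P n)))) = 0
    rw [hL, map_smul, hu]
    rcases n with _ | n <;> simp
  have key : ∀ q : ℂ[X], u 0 (a1 * derivative q) + (2 : ℂ)⁻¹ * u 0 (a2 * derivative (derivative q)) = 0 := by
    intro q
    have h := LinearMap.congr_fun huL q
    change u 0 (a1 * derivative q + (2 : ℂ)⁻¹ • (a2 * derivative (derivative q))) = 0 at h
    rwa [map_add, map_smul, smul_eq_mul] at h
  have hcoef : (C (-2 * a1.coeff 1) * X + C (a1.coeff 1 * β 0 - a1.coeff 0) : ℂ[X]) = (-2 : ℂ) • a1 := by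
    rw [smul_eq_C_mul]
    conv_rhs => rw [hb1]
    rw [hc0]
    simp only [C_mul, C_sub, C_neg]
    rw [show (C (2 : ℂ)) = 2 from rfl]
    ring
  rw [hcoef]
  refine Polynomial.lhom_ext' fun n => LinearMap.ext_ring ?_
  have hq : derivative (monomial (n + 1) (((n : ℂ) + 1)⁻¹)) = monomial n (1 : ℂ) := by
    rw [derivative_monomial]
    have : (n : ℂ) + 1 ≠ 0 := Nat.cast_add_one_ne_zero n
    simp [this]
  have h := key (monomial (n + 1) (((n : ℂ) + 1)⁻¹))
  rw [hq] at h
  change - u 0 (a2 * derivative (monomial n (1 : ℂ))) + u 0 (((-2 : ℂ) • a1) * monomial n (1 : ℂ)) = 0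
  rw [smul_mul_assoc, map_smul, smul_eq_mul]
  linear_combination (-2) * h
end

section
/- In the setting where a_0, a_1, a_2 are polynomials with deg a_ν ≤ ν, J = a_0 I + a_1 D + (a_2/2)D², λ_n^{[0]} = a_0^{[0]} + n·a_1^{[1]} + (n(n−1)/2)·a_2^{[2]} ≠ 0 for all n, (P_n) is a MOPS with respect to u_0 with recurrence coefficients (β_n), (γ_{n+1}), a_1^{[1]} ≠ 0, and J(P_n) = λ_n^{[0]}P_n for all n: assume moreover deg a_2 = 2 (so a_2^{[2]} ≠ 0) and that μ := −a_0^{[2]}/a_2^{[2]} + (a_1^{[2]}/(2a_2^{[2]}))² = 0, and set d = −a_1^{[2]}/(2a_2^{[2]}) and α = a_1^{[1]}/a_2^{[2]}. Then the functional ũ_0 = τ_{−d}u_0 satisfies the Bessel-type equation D(x²·ũ_0) − 2α(x − (β_0 − d))·ũ_0 = 0. -/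
open Polynomial

/-- Translation of a functional: `⟨τ_b u, p⟩ = ⟨u, p(x+b)⟩`. -/
noncomputable def tauD (b : ℂ) (u : Module.Dual ℂ ℂ[X]) : Module.Dual ℂ ℂ[X] :=
  u ∘ₗ (Polynomial.aeval (X + C b) : ℂ[X] →ₐ[ℂ] ℂ[X]).toLinearMap

lemma span_P_top (β γ : ℕ → ℂ) (P : ℕ → ℂ[X])
    (hP0 : P 0 = 1) (hP1 : P 1 = X - C (β 0))
    (hPrec : ∀ n : ℕ, P (n + 2) = (X - C (β (n + 1))) * P (n + 1) - C (γ (n + 1)) * P n)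
    (q : ℂ[X]) : q ∈ Submodule.span ℂ (Set.range P) := by
  have hmem : ∀ n, P n ∈ Submodule.span ℂ (Set.range P) :=
    fun n => Submodule.subset_span ⟨n, rfl⟩
  have hX : ∀ p ∈ Submodule.span ℂ (Set.range P), X * p ∈ Submodule.span ℂ (Set.range P) := by
    intro p hp
    induction hp using Submodule.span_induction with
    | mem x hx =>
      obtain ⟨n, rfl⟩ := hx
      rcases n with _ | n
      · have : X * P 0 = P 1 + β 0 • P 0 := by
          rw [hP0, hP1, smul_eq_C_mul]; ring
        rw [this]
        exact add_mem (hmem _) (Submodule.smul_mem _ _ (hmem _))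
      · have : X * P (n + 1) = P (n + 2) + β (n + 1) • P (n + 1) + γ (n + 1) • P n := by
          rw [hPrec, smul_eq_C_mul, smul_eq_C_mul]; ring
        rw [this]
        exact add_mem (add_mem (hmem _) (Submodule.smul_mem _ _ (hmem _)))
          (Submodule.smul_mem _ _ (hmem _))
    | zero => simp
    | add x y _ _ hx hy => rw [mul_add]; exact add_mem hx hy
    | smul a x _ hx => rw [mul_smul_comm]; exact Submodule.smul_mem _ _ hx
  have hpow : ∀ n : ℕ, (X : ℂ[X]) ^ n ∈ Submodule.span ℂ (Set.range P) := by
    intro n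
    induction n with
    | zero => rw [pow_zero, ← hP0]; exact hmem 0
    | succ n ih => rw [pow_succ']; exact hX _ ih
  induction q using Polynomial.induction_on' with
  | add p q hp hq => exact add_mem hp hq
  | monomial n a =>
    rw [← C_mul_X_pow_eq_monomial, ← smul_eq_C_mul]
    exact Submodule.smul_mem _ _ (hpow n)

lemma exists_antideriv (r : ℂ[X]) : ∃ q : ℂ[X], derivative q = r := by
  induction r using Polynomial.induction_on' with
  | add p q hp hq =>
    obtain ⟨a, ha⟩ := hp
    obtain ⟨b, hb⟩ := hq
    exact ⟨a + b, by rw [derivative_add, ha, hb]⟩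
  | monomial n a =>
    refine ⟨monomial (n + 1) (a / ((n : ℂ) + 1)), ?_⟩
    rw [derivative_monomial]
    have : (n : ℂ) + 1 ≠ 0 := Nat.cast_add_one_ne_zero n
    simp [div_mul_cancel₀ _ this]

/-- in the isomorphism case with `deg a_2 = 2` and `μ = 0`, the translated
functional `ũ_0 = τ_{−d} u_0` satisfies the Bessel-type equation
`D(x² ũ_0) − 2α(x − (β_0 − d)) ũ_0 = 0`, where `d = −a_1^{[2]}/(2a_2^{[2]})` and
`α = a_1^{[1]}/a_2^{[2]}`. -/
theorem isomorphism_case_Bessel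
    (a0 a1 a2 : ℂ[X])
    (h0 : a0.degree ≤ 0) (h1 : a1.degree ≤ 1) (h2 : a2.degree ≤ 2)
    (hdeg2 : a2.degree = 2)
    (hlam : ∀ n : ℕ,
      a0.coeff 0 + (n : ℂ) * a1.coeff 1 + ((n : ℂ) * ((n : ℂ) - 1) / 2) * a2.coeff 2 ≠ 0)
    (ha11 : a1.coeff 1 ≠ 0)
    (β γ : ℕ → ℂ) (P : ℕ → ℂ[X])
    (hP0 : P 0 = 1) (hP1 : P 1 = X - C (β 0))
    (hPrec : ∀ n : ℕ, P (n + 2) = (X - C (β (n + 1))) * P (n + 1) - C (γ (n + 1)) * P n)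
    (hγ : ∀ n : ℕ, γ (n + 1) ≠ 0)
    (u : ℕ → Module.Dual ℂ ℂ[X])
    (hu : ∀ n m : ℕ, u n (P m) = if n = m then 1 else 0)
    (hJ : ∀ n : ℕ,
      a0 * P n + a1 * derivative (P n) + (2 : ℂ)⁻¹ • (a2 * derivative (derivative (P n))) =
        (a0.coeff 0 + (n : ℂ) * a1.coeff 1 + ((n : ℂ) * ((n : ℂ) - 1) / 2) * a2.coeff 2) • P n)
    (hμ : -(a2.coeff 0) / a2.coeff 2 + (a2.coeff 1 / (2 * a2.coeff 2)) ^ 2 = 0)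
    (d α : ℂ)
    (hd : d = -(a2.coeff 1) / (2 * a2.coeff 2)) (hα : α = a1.coeff 1 / a2.coeff 2) :
    derD (lmulD (X ^ 2) (tauD (-d) (u 0))) -
      lmulD (C (2 * α) * (X - C (β 0 - d))) (tauD (-d) (u 0)) = 0 := by
  have hA : a2.coeff 2 ≠ 0 := by
    have := coeff_natDegree (p := a2)
    rw [natDegree_eq_of_degree_eq_some (n := 2) hdeg2] at this
    rw [this]
    intro h
    rw [leadingCoeff_eq_zero] at h
    simp [h] at hdeg2
  have ha0 : a0 = C (a0.coeff 0) := eq_C_of_degree_le_zero h0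
  have e2 : a2 = C (a2.coeff 2) * (X - C d) ^ 2 := by
    have hq : a2 = C (a2.coeff 2) * X ^ 2 + C (a2.coeff 1) * X + C (a2.coeff 0) :=
      eq_quadratic_of_degree_le_two h2
    have k1 : a2.coeff 1 = -(2 * a2.coeff 2 * d) := by rw [hd]; field_simp
    have k0 : a2.coeff 0 = a2.coeff 2 * d ^ 2 := by
      have : d ^ 2 = a2.coeff 0 / a2.coeff 2 := by
        rw [hd]; linear_combination hμ
      rw [this]; field_simp
    rw [k1, k0] at hq
    conv_lhs => rw [hq]
    simp only [C_neg, C_mul, C_pow, C_ofNat]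
    ring
  have e1 : a1 = C (a1.coeff 1) * (X - C (β 0)) := by
    have h := hJ 1
    rw [hP1, ha0] at h
    simp [smul_eq_C_mul] at h
    linear_combination h
  generalize a2.coeff 2 = A at *
  generalize a1.coeff 1 = B at *
  have key : ∀ q : ℂ[X], u 0 (a1 * derivative q + (2 : ℂ)⁻¹ • (a2 * derivative (derivative q)))
      = 0 := by
    intro q
    have hq := span_P_top β γ P hP0 hP1 hPrec q
    induction hq using Submodule.span_induction with
    | mem x hx =>
      obtain ⟨n, rfl⟩ := hx
      rcases n with _ | n
      · simp [hP0]
      · have h := congrArg (u 0) (hJ (n + 1))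
        rw [ha0, add_assoc, map_add, ← smul_eq_C_mul, map_smul, map_smul, hu] at h
        simpa using h
    | zero => simp
    | add x y _ _ hx hy =>
      have h := congrArg₂ (· + ·) hx hy
      simp only [← map_add, add_zero] at h
      rw [← h]
      congr 1
      simp only [map_add, mul_add, smul_add]
      abel
    | smul a x _ hx =>
      have h : u 0 (a • (a1 * derivative x + (2 : ℂ)⁻¹ • (a2 * derivative (derivative x)))) = 0 := by
        rw [map_smul, hx, smul_zero]
      rw [← h]
      congr 1
      simp only [derivative_smul, smul_add, mul_smul_comm]
      rw [smul_comm]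
  have key2 : ∀ r : ℂ[X],
      u 0 (C (2 * α) * (X - C (β 0)) * r + (X - C d) ^ 2 * derivative r) = 0 := by
    intro r
    obtain ⟨q, rfl⟩ := exists_antideriv r
    have h : u 0 ((2 / A) • (a1 * derivative q +
        (2 : ℂ)⁻¹ • (a2 * derivative (derivative q)))) = 0 := by
      rw [map_smul, key q, smul_zero]
    rw [← h]
    congr 1
    have hc : C (2 / A) * C A = C (2 : ℂ) := by
      rw [← C_mul]; congr 1; field_simp
    have hb : C (2 * α) = C (2 / A) * C B := by
      rw [← C_mul, hα]; congr 1; ring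
    have h2' : C (2 : ℂ) * C (2 : ℂ)⁻¹ = 1 := by
      rw [← C_mul, mul_inv_cancel₀ two_ne_zero, C_1]
    rw [e1, e2, hb]
    simp only [smul_eq_C_mul]
    linear_combination (-(X - C d) ^ 2 * derivative (derivative q)) * h2'
      - (C (2 : ℂ)⁻¹ * (X - C d) ^ 2 * derivative (derivative q)) * hc
  ext1 n
  ext
  simp only [derD, lmulD, tauD, LinearMap.comp_apply, LinearMap.sub_apply, LinearMap.neg_apply,
    LinearMap.mulLeft_apply, LinearMap.zero_apply, AlgHom.toLinearMap_apply, map_mul]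
  generalize (monomial n) (1 : ℂ) = p
  have h := key2 (aeval (X + C (-d)) p)
  have hder : derivative (aeval (X + C (-d)) p) = aeval (X + C (-d)) (derivative p) := by
    simp only [← comp_eq_aeval, derivative_comp]
    simp
  rw [hder, map_add] at h
  have e3 : (aeval (X + C (-d))) (X - C (β 0 - d)) = (X - C (β 0) : ℂ[X]) := by
    simp [aeval_C, algebraMap_eq]
    ring
  have e4 : (aeval (X + C (-d))) ((X : ℂ[X]) ^ 2) = ((X - C d) ^ 2 : ℂ[X]) := by
    simp [sub_eq_add_neg]
  have e5 : ∀ c : ℂ, (aeval (X + C (-d))) (C c) = (C c : ℂ[X]) := by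
    intro c; simp [aeval_C, algebraMap_eq]
  rw [e3, e4, e5, e5, ← C_mul]
  linear_combination -h
end

section
/- In the setting where a_0, a_1, a_2 are polynomials with deg a_ν ≤ ν, J = a_0 I + a_1 D + (a_2/2)D², λ_n^{[0]} = a_0^{[0]} + n·a_1^{[1]} + (n(n−1)/2)·a_2^{[2]} ≠ 0 for all n, (P_n) is a MOPS with respect to u_0 with recurrence coefficients (β_n), (γ_{n+1}), a_1^{[1]} ≠ 0, and J(P_n) = λ_n^{[0]}P_n for all n: assume moreover deg a_2 = 1 (so a_2^{[2]} = 0 and a_1^{[2]} ≠ 0), and set A = −a_1^{[2]}/(2a_1^{[1]}) and B = −a_0^{[2]}/a_1^{[2]}. Then the functional ũ_0 = (h_{A^{-1}} ∘ τ_{−B})u_0 satisfies the Laguerre equation D(x·ũ_0) + (x − α − 1)·ũ_0 = 0 with parameter α = −1 + (2/a_1^{[2]})·(a_0^{[1]} − a_0^{[2]}a_1^{[1]}/a_1^{[2]}). -/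
open Polynomial

/-- Dilation of a functional: `⟨h_a u, p⟩ = ⟨u, p(ax)⟩`. -/
noncomputable def hDil (A : ℂ) (u : Module.Dual ℂ ℂ[X]) : Module.Dual ℂ ℂ[X] :=
  u ∘ₗ (Polynomial.aeval (C A * X) : ℂ[X] →ₐ[ℂ] ℂ[X]).toLinearMap

theorem aux_ext (P : ℕ → ℂ[X]) (β γ : ℕ → ℂ)
    (hP0 : P 0 = 1) (hP1 : P 1 = X - C (β 0))
    (hPrec : ∀ n : ℕ, P (n + 2) = (X - C (β (n + 1))) * P (n + 1) - C (γ (n + 1)) * P n)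
    (w : Module.Dual ℂ ℂ[X]) (hw : ∀ n, w (P n) = 0) : w = 0 := by
  have hX : ∀ q ∈ Submodule.span ℂ (Set.range P), X * q ∈ Submodule.span ℂ (Set.range P) := by
    have hm : ∀ n, P n ∈ Submodule.span ℂ (Set.range P) := fun n =>
      Submodule.subset_span ⟨n, rfl⟩
    intro q hq
    induction hq using Submodule.span_induction with
    | mem x hx =>
      obtain ⟨n, rfl⟩ := hx
      cases n with
      | zero =>
        have : X * P 0 = P 1 + β 0 • P 0 := by
          rw [hP1, hP0, smul_eq_C_mul]; ring
        rw [this]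
        exact add_mem (hm _) (Submodule.smul_mem _ _ (hm _))
      | succ n =>
        have : X * P (n+1) = P (n+2) + β (n+1) • P (n+1) + γ (n+1) • P n := by
          rw [hPrec, smul_eq_C_mul, smul_eq_C_mul]; ring
        rw [this]
        exact add_mem (add_mem (hm _) (Submodule.smul_mem _ _ (hm _)))
          (Submodule.smul_mem _ _ (hm _))
    | zero => simp
    | add x y _ _ hx hy => rw [mul_add]; exact add_mem hx hy
    | smul a x _ hx => rw [mul_smul_comm]; exact Submodule.smul_mem _ _ hx
  have hXn : ∀ n : ℕ, (X : ℂ[X]) ^ n ∈ Submodule.span ℂ (Set.range P) := by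
    intro n
    induction n with
    | zero => rw [pow_zero, ← hP0]; exact Submodule.subset_span ⟨0, rfl⟩
    | succ n ih => rw [pow_succ']; exact hX _ ih
  have hz : ∀ q ∈ Submodule.span ℂ (Set.range P), w q = 0 := by
    intro q hq
    induction hq using Submodule.span_induction with
    | mem x hx => obtain ⟨n, rfl⟩ := hx; exact hw n
    | zero => simp
    | add x y _ _ hx hy => rw [map_add, hx, hy, add_zero]
    | smul a x _ hx => rw [map_smul, hx, smul_zero]
  ext n
  simpa [← X_pow_eq_monomial] using hz _ (hXn n)

theorem aux_antideriv (p : ℂ[X]) : ∃ q : ℂ[X], derivative q = p := by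
  induction p using Polynomial.induction_on' with
  | add p q hp hq =>
    obtain ⟨a, rfl⟩ := hp
    obtain ⟨b, rfl⟩ := hq
    exact ⟨a + b, by simp⟩
  | monomial n a =>
    refine ⟨monomial (n+1) (a / (n+1)), ?_⟩
    rw [derivative_monomial]
    have : (n : ℂ) + 1 ≠ 0 := Nat.cast_add_one_ne_zero n
    push_cast
    rw [div_mul_cancel₀ _ this]

/-- in the isomorphism case with `deg a_2 = 1`, the functional
`ũ_0 = (h_{A⁻¹} ∘ τ_{−B}) u_0` with `A = −a_1^{[2]}/(2a_1^{[1]})`, `B = −a_0^{[2]}/a_1^{[2]}`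
satisfies the Laguerre equation `D(x ũ_0) + (x − α − 1) ũ_0 = 0` with
`α = −1 + (2/a_1^{[2]})(a_0^{[1]} − a_0^{[2]}a_1^{[1]}/a_1^{[2]})`. -/
theorem isomorphism_case_Laguerre
    (a0 a1 a2 : ℂ[X])
    (h0 : a0.degree ≤ 0) (h1 : a1.degree ≤ 1) (h2 : a2.degree ≤ 2)
    (hdeg1 : a2.degree = 1)
    (hlam : ∀ n : ℕ,
      a0.coeff 0 + (n : ℂ) * a1.coeff 1 + ((n : ℂ) * ((n : ℂ) - 1) / 2) * a2.coeff 2 ≠ 0)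
    (ha11 : a1.coeff 1 ≠ 0)
    (β γ : ℕ → ℂ) (P : ℕ → ℂ[X])
    (hP0 : P 0 = 1) (hP1 : P 1 = X - C (β 0))
    (hPrec : ∀ n : ℕ, P (n + 2) = (X - C (β (n + 1))) * P (n + 1) - C (γ (n + 1)) * P n)
    (hγ : ∀ n : ℕ, γ (n + 1) ≠ 0)
    (u : ℕ → Module.Dual ℂ ℂ[X])
    (hu : ∀ n m : ℕ, u n (P m) = if n = m then 1 else 0)
    (hJ : ∀ n : ℕ,
      a0 * P n + a1 * derivative (P n) + (2 : ℂ)⁻¹ • (a2 * derivative (derivative (P n))) =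
        (a0.coeff 0 + (n : ℂ) * a1.coeff 1 + ((n : ℂ) * ((n : ℂ) - 1) / 2) * a2.coeff 2) • P n)
    (A B α : ℂ)
    (hA : A = -(a2.coeff 1) / (2 * a1.coeff 1)) (hB : B = -(a2.coeff 0) / a2.coeff 1)
    (hα : α = -1 + 2 / a2.coeff 1 * (a1.coeff 0 - a2.coeff 0 * a1.coeff 1 / a2.coeff 1)) :
    derD (lmulD X (hDil A⁻¹ (tauD (-B) (u 0)))) +
      lmulD (X - C (α + 1)) (hDil A⁻¹ (tauD (-B) (u 0))) = 0 := by
  have c22 : a2.coeff 2 = 0 := coeff_eq_zero_of_degree_lt (by rw [hdeg1]; norm_num)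
  have c21 : a2.coeff 1 ≠ 0 := coeff_ne_zero_of_eq_degree hdeg1
  have e0 : a0 = C (a0.coeff 0) := eq_C_of_degree_le_zero h0
  have e1 : a1 = C (a1.coeff 1) * X + C (a1.coeff 0) := eq_X_add_C_of_degree_le_one h1
  have e2 : a2 = C (a2.coeff 1) * X + C (a2.coeff 0) := eq_X_add_C_of_degree_le_one hdeg1.le
  have hAne : A ≠ 0 := by
    rw [hA]; exact div_ne_zero (neg_ne_zero.mpr c21) (mul_ne_zero two_ne_zero ha11)
  have key : u 0 ∘ₗ ((LinearMap.mulLeft ℂ a1) ∘ₗ (derivative : ℂ[X] →ₗ[ℂ] ℂ[X]) +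
      (2 : ℂ)⁻¹ • ((LinearMap.mulLeft ℂ a2) ∘ₗ (derivative : ℂ[X] →ₗ[ℂ] ℂ[X]) ∘ₗ
        (derivative : ℂ[X] →ₗ[ℂ] ℂ[X]))) = 0 := by
    refine aux_ext P β γ hP0 hP1 hPrec _ fun n => ?_
    have h := hJ n
    rw [c22, mul_zero, add_zero, add_smul, add_assoc] at h
    have h' : a0 * P n = a0.coeff 0 • P n := by
      rw [smul_eq_C_mul, ← e0]
    rw [h'] at h
    have h3 := add_left_cancel h
    simp only [LinearMap.comp_apply, LinearMap.add_apply, LinearMap.smul_apply,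
      LinearMap.mulLeft_apply]
    rw [h3, map_smul, hu]
    rcases n with _ | n <;> simp
  have key2 : ∀ r : ℂ[X], u 0 (a1 * r + (2 : ℂ)⁻¹ • (a2 * derivative r)) = 0 := by
    intro r
    obtain ⟨q, rfl⟩ := aux_antideriv r
    exact LinearMap.congr_fun key q
  refine LinearMap.ext fun p => ?_
  set y : ℂ[X] := C A⁻¹ * (X + C (-B)) with hy
  have hT : ∀ q : ℂ[X], hDil A⁻¹ (tauD (-B) (u 0)) q = u 0 (q.comp y) := by
    intro q
    simp only [hDil, tauD, LinearMap.comp_apply, AlgHom.toLinearMap_apply]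
    congr 1
    change aeval _ (q.comp _) = q.comp y
    rw [← comp_eq_aeval, comp_assoc]
    simp [hy]
  have hk := key2 (p.comp y)
  have hyX : X = C A * y + C B := by
    rw [hy, ← mul_assoc, ← C_mul, mul_inv_cancel₀ hAne]; simp
  have hdy : derivative y = C A⁻¹ := by simp [hy]
  have hcalc : a1 * p.comp y + (2 : ℂ)⁻¹ • (a2 * derivative (p.comp y)) =
      (-(a2.coeff 1) / 2) • ((-(X * derivative p) + (X - C (α+1)) * p).comp y) := by
    have q1 : a1 = C (-(a2.coeff 1) / 2) * (y - C (α+1)) := by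
      have s1 : a1.coeff 1 * A = -(a2.coeff 1) / 2 := by rw [hA]; field_simp
      have s2 : a1.coeff 1 * B + a1.coeff 0 = -(-(a2.coeff 1) / 2 * (α + 1)) := by
        rw [hB, hα]; field_simp; ring
      have s1' := congrArg C s1
      have s2' := congrArg C s2
      simp only [C_mul, C_add, C_neg] at s1' s2'
      conv_lhs => rw [e1, hyX]
      simp only [C_add] at s2' ⊢
      linear_combination y * s1' + s2'
    have q2 : a2 * C A⁻¹ = C (a2.coeff 1) * y := by
      have s1 : -(a2.coeff 1 * B) = a2.coeff 0 := by rw [hB]; field_simp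
      conv_lhs => rw [e2]
      rw [hy, ← s1]
      simp only [C_mul, C_neg]; ring
    have q3 : (C (2:ℂ)⁻¹ : ℂ[X]) * C (a2.coeff 1) = - C (-(a2.coeff 1) / 2) := by
      rw [← C_mul, ← C_neg]; congr 1; ring
    rw [derivative_comp, hdy, smul_eq_C_mul, smul_eq_C_mul]
    simp only [add_comp, neg_comp, mul_comp, sub_comp, X_comp, C_comp]
    linear_combination (p.comp y) * q1 + C (2:ℂ)⁻¹ * (derivative p).comp y * q2 +
      y * (derivative p).comp y * q3
  rw [hcalc, map_smul, smul_eq_mul] at hk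
  have hk' := (mul_eq_zero.mp hk).resolve_left (div_ne_zero (neg_ne_zero.mpr c21) two_ne_zero)
  rw [← hT, map_add, map_neg] at hk'
  simpa [derD, lmulD] using hk'
end

section
/- In the setting where a_0, a_1, a_2 are polynomials with deg a_ν ≤ ν, J = a_0 I + a_1 D + (a_2/2)D², λ_n^{[0]} = a_0^{[0]} + n·a_1^{[1]} + (n(n−1)/2)·a_2^{[2]} ≠ 0 for all n, (P_n) is a MOPS with respect to u_0 with recurrence coefficients (β_n), (γ_{n+1}), a_1^{[1]} ≠ 0, and J(P_n) = λ_n^{[0]}P_n for all n: assume moreover deg a_2 = 0 with a_2 = a_0^{[2]} ≠ 0, fix a square root A of −a_0^{[2]}/a_1^{[1]}, and set B = −a_0^{[1]}/a_1^{[1]}. Then the functional ũ_0 = (h_{A^{-1}} ∘ τ_{−B})u_0 satisfies the Hermite equation D(ũ_0) + 2x·ũ_0 = 0. -/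
open Polynomial

theorem span_of_recurrence (β γ : ℕ → ℂ) (P : ℕ → ℂ[X])
    (hP0 : P 0 = 1) (hP1 : P 1 = X - C (β 0))
    (hPrec : ∀ n : ℕ, P (n + 2) = (X - C (β (n + 1))) * P (n + 1) - C (γ (n + 1)) * P n)
    (p : ℂ[X]) : p ∈ Submodule.span ℂ (Set.range P) := by
  have hmem : ∀ n, P n ∈ Submodule.span ℂ (Set.range P) :=
    fun n => Submodule.subset_span ⟨n, rfl⟩
  have hX : ∀ q ∈ Submodule.span ℂ (Set.range P), X * q ∈ Submodule.span ℂ (Set.range P) := by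
    intro q hq
    induction hq using Submodule.span_induction with
    | mem x hx =>
      obtain ⟨n, rfl⟩ := hx
      rcases n with _ | n
      · have : X * P 0 = P 1 + β 0 • P 0 := by
          rw [hP0, hP1, smul_eq_C_mul]; ring
        rw [this]
        exact Submodule.add_mem _ (hmem _) (Submodule.smul_mem _ _ (hmem _))
      · have : X * P (n + 1) = P (n + 2) + β (n + 1) • P (n + 1) + γ (n + 1) • P n := by
          rw [hPrec, smul_eq_C_mul, smul_eq_C_mul]; ring
        rw [this]
        exact Submodule.add_mem _ (Submodule.add_mem _ (hmem _)
          (Submodule.smul_mem _ _ (hmem _))) (Submodule.smul_mem _ _ (hmem _))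
    | zero => simp
    | add x y _ _ hx hy => rw [mul_add]; exact Submodule.add_mem _ hx hy
    | smul a x _ hx => rw [mul_smul_comm]; exact Submodule.smul_mem _ _ hx
  have hpow : ∀ n : ℕ, (X : ℂ[X]) ^ n ∈ Submodule.span ℂ (Set.range P) := by
    intro n
    induction n with
    | zero => rw [pow_zero, ← hP0]; exact hmem 0
    | succ n ih => rw [pow_succ']; exact hX _ ih
  induction p using Polynomial.induction_on' with
  | add p q hp hq => exact Submodule.add_mem _ hp hq
  | monomial n a =>
    rw [← C_mul_X_pow_eq_monomial, ← smul_eq_C_mul]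
    exact Submodule.smul_mem _ _ (hpow n)

theorem exists_primitive (q : ℂ[X]) : ∃ p : ℂ[X], derivative p = q := by
  induction q using Polynomial.induction_on' with
  | add p q hp hq =>
    obtain ⟨a, rfl⟩ := hp
    obtain ⟨b, rfl⟩ := hq
    exact ⟨a + b, derivative_add⟩
  | monomial n a =>
    refine ⟨monomial (n + 1) (a / ((n : ℂ) + 1)), ?_⟩
    have : ((n : ℂ) + 1) ≠ 0 := Nat.cast_add_one_ne_zero n
    rw [derivative_monomial]
    simp [this]

/-- in the isomorphism case with `deg a_2 = 0` (`a_2 = a_0^{[2]} ≠ 0`), the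
functional `ũ_0 = (h_{A⁻¹} ∘ τ_{−B}) u_0` with `A² = −a_0^{[2]}/a_1^{[1]}` and
`B = −a_0^{[1]}/a_1^{[1]}` satisfies the Hermite equation `D(ũ_0) + 2x ũ_0 = 0`. -/
theorem isomorphism_case_Hermite
    (a0 a1 a2 : ℂ[X])
    (h0 : a0.degree ≤ 0) (h1 : a1.degree ≤ 1) (h2 : a2.degree ≤ 2)
    (hdeg0 : a2.degree = 0)
    (hlam : ∀ n : ℕ,
      a0.coeff 0 + (n : ℂ) * a1.coeff 1 + ((n : ℂ) * ((n : ℂ) - 1) / 2) * a2.coeff 2 ≠ 0)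
    (ha11 : a1.coeff 1 ≠ 0)
    (β γ : ℕ → ℂ) (P : ℕ → ℂ[X])
    (hP0 : P 0 = 1) (hP1 : P 1 = X - C (β 0))
    (hPrec : ∀ n : ℕ, P (n + 2) = (X - C (β (n + 1))) * P (n + 1) - C (γ (n + 1)) * P n)
    (hγ : ∀ n : ℕ, γ (n + 1) ≠ 0)
    (u : ℕ → Module.Dual ℂ ℂ[X])
    (hu : ∀ n m : ℕ, u n (P m) = if n = m then 1 else 0)
    (hJ : ∀ n : ℕ,
      a0 * P n + a1 * derivative (P n) + (2 : ℂ)⁻¹ • (a2 * derivative (derivative (P n))) =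
        (a0.coeff 0 + (n : ℂ) * a1.coeff 1 + ((n : ℂ) * ((n : ℂ) - 1) / 2) * a2.coeff 2) • P n)
    (A B : ℂ)
    (hA : A ^ 2 = -(a2.coeff 0) / a1.coeff 1) (hB : B = -(a1.coeff 0) / a1.coeff 1) :
    derD (hDil A⁻¹ (tauD (-B) (u 0))) +
      lmulD (C 2 * X) (hDil A⁻¹ (tauD (-B) (u 0))) = 0 := by
  obtain ⟨c, hc⟩ : ∃ c, a2 = C c := ⟨_, eq_C_of_degree_le_zero hdeg0.le⟩
  obtain ⟨d, hd⟩ : ∃ d, a0 = C d := ⟨_, eq_C_of_degree_le_zero h0⟩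
  have hc0 : c ≠ 0 := by
    rintro rfl
    simp [hc] at hdeg0
  have ha1 := eq_X_add_C_of_degree_le_one h1
  generalize a1.coeff 1 = s at *
  generalize a1.coeff 0 = t at *
  subst hc hd ha1
  simp only [coeff_C_zero] at hA
  have hA0 : A ≠ 0 := by
    rintro rfl
    have : -c / s = 0 := by rw [← hA]; simp
    simp [hc0, ha11] at this
  -- the functional equation tested against derivatives
  have key : ∀ p : ℂ[X], u 0 ((C s * X + C t) * derivative p +
      (2 : ℂ)⁻¹ • (C c * derivative (derivative p))) = 0 := by
    intro p
    have hp := span_of_recurrence β γ P hP0 hP1 hPrec p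
    induction hp using Submodule.span_induction with
    | mem x hx =>
      obtain ⟨n, rfl⟩ := hx
      have h := hJ n
      have e : (C s * X + C t) * derivative (P n) +
          (2 : ℂ)⁻¹ • (C c * derivative (derivative (P n))) = ((n : ℂ) * s) • P n := by
        simp only [coeff_C_zero, coeff_C_succ, mul_zero, add_zero, add_smul] at h
        rw [← smul_eq_C_mul d, add_assoc] at h
        exact add_left_cancel h
      rw [e, map_smul, hu]
      rcases n with _ | n <;> simp
    | zero => simp
    | add x y _ _ hx hy =>
      rw [← add_zero (0 : ℂ)]
      nth_rewrite 1 [← hx]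
      rw [← hy, ← map_add]
      congr 1
      simp only [derivative_add, mul_add, smul_add]
      ring
    | smul a x _ hx =>
      have hx2 := congrArg (fun z => a • z) hx
      simp only [smul_zero] at hx2
      rw [← hx2, ← map_smul]
      congr 1
      simp only [derivative_smul, mul_smul_comm, smul_add]
      rw [smul_comm]
  have key2 : ∀ q : ℂ[X], s * u 0 ((X - C B) * q) + c / 2 * u 0 (derivative q) = 0 := by
    intro q
    obtain ⟨p, rfl⟩ := exists_primitive q
    rw [← key p, ← smul_eq_mul s, ← smul_eq_mul (c / 2), ← map_smul (u 0), ← map_smul (u 0),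
      ← map_add (u 0)]
    congr 1
    have ht : C t = -(C s * C B) := by
      rw [← C_mul, ← C_neg]; congr 1; rw [hB]; field_simp
    rw [ht]
    simp only [smul_eq_C_mul, div_eq_mul_inv, C_mul]
    ring
  refine LinearMap.ext fun p => ?_
  have hc2 : c = -(A ^ 2 * s) := by rw [hA]; field_simp
  set q : ℂ[X] := aeval (X + C (-B)) (aeval (C A⁻¹ * X) p) with hq
  have hqc : ∀ r : ℂ[X], aeval (X + C (-B)) (aeval (C A⁻¹ * X) r) =
      r.comp (C A⁻¹ * (X - C B)) := by
    intro r
    rw [← comp_eq_aeval, ← comp_eq_aeval, comp_assoc]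
    simp [sub_eq_add_neg]
  have hdq : derivative q = A⁻¹ • (derivative p).comp (C A⁻¹ * (X - C B)) := by
    rw [hq, hqc, derivative_comp, smul_eq_C_mul]
    simp
  have h := key2 q
  rw [hdq, map_smul, smul_eq_mul, hc2, hq, hqc] at h
  have e1 : derD (hDil A⁻¹ (tauD (-B) (u 0))) p =
      - u 0 ((derivative p).comp (C A⁻¹ * (X - C B))) := by
    rw [← hqc]; rfl
  have e2 : lmulD (C 2 * X) (hDil A⁻¹ (tauD (-B) (u 0))) p =
      2 * A⁻¹ * u 0 ((X - C B) * p.comp (C A⁻¹ * (X - C B))) := by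
    have : lmulD (C 2 * X) (hDil A⁻¹ (tauD (-B) (u 0))) p =
      u 0 (aeval (X + C (-B)) (aeval (C A⁻¹ * X) (C 2 * X * p))) := rfl
    rw [this, hqc, ← smul_eq_mul (2 * A⁻¹), ← map_smul]
    congr 1
    rw [mul_comp, mul_comp, X_comp, C_comp, smul_eq_C_mul, C_mul]
    ring
  rw [LinearMap.add_apply, e1, e2, LinearMap.zero_apply]
  generalize u 0 ((derivative p).comp (C A⁻¹ * (X - C B))) = x at *
  generalize u 0 ((X - C B) * p.comp (C A⁻¹ * (X - C B))) = y at *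
  have h3 : s * (2 * y - A * x) = 0 := by
    have : s * (2 * y - A * x) = 2 * (s * y + -(A ^ 2 * s) / 2 * (A⁻¹ * x)) := by
      field_simp
      ring
    rw [this, h, mul_zero]
  have h4 : 2 * y - A * x = 0 := (mul_eq_zero.mp h3).resolve_left ha11
  have : -x + 2 * A⁻¹ * y = A⁻¹ * (2 * y - A * x) := by
    field_simp
    ring
  rw [this, h4, mul_zero]
end

section
/- Let a_0^{[1]}, a_0^{[2]}, a_1^{[2]} ∈ ℂ, set a_1(x) = a_0^{[1]} and a_2(x) = a_0^{[2]} + a_1^{[2]}x, let J = a_1(x)D + (a_2(x)/2)D², and assume λ_{n+1}^{[1]} := (n+1)a_0^{[1]} + (n(n+1)/2)·a_1^{[2]} ≠ 0 for all n ≥ 0 (in particular a_0^{[1]} ≠ 0). Let (P_n)_{n≥0} be a monic orthogonal polynomial sequence with respect to u_0, with recurrence coefficients (β_n), (γ_{n+1}), and suppose J(P_{n+1}) = λ_{n+1}^{[1]}·P_n for every n ≥ 0. Then u_0 satisfies the functional identity D(a_2(x)·u_0) + ( (λ_1^{[1]}/γ_1)·(x−β_0)² − (λ_2^{[1]}/γ_2)·P_2(x)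 − a_0^{[1]} )·u_0 = 0. -/
open Polynomial

theorem dual_ext_of_rec (β γ : ℕ → ℂ) (P : ℕ → ℂ[X])
    (hP0 : P 0 = 1) (hP1 : P 1 = X - C (β 0))
    (hPrec : ∀ n : ℕ, P (n + 2) = (X - C (β (n + 1))) * P (n + 1) - C (γ (n + 1)) * P n)
    (v w : Module.Dual ℂ ℂ[X]) (h : ∀ n, v (P n) = w (P n)) : v = w := by
  have key : ∀ f : ℂ[X], f ∈ Submodule.span ℂ (Set.range P) → 
      X * f ∈ Submodule.span ℂ (Set.range P) := by
    intro f hf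
    induction hf using Submodule.span_induction with
    | mem x hx =>
      obtain ⟨n, rfl⟩ := hx
      have hm : ∀ k, P k ∈ Submodule.span ℂ (Set.range P) :=
        fun k => Submodule.subset_span ⟨k, rfl⟩
      cases n with
      | zero =>
        have : X * P 0 = P 1 + β 0 • P 0 := by
          rw [hP0, hP1, smul_eq_C_mul]; ring
        rw [this]
        exact Submodule.add_mem _ (hm _) (Submodule.smul_mem _ _ (hm _))
      | succ n =>
        have : X * P (n+1) = P (n+2) + β (n+1) • P (n+1) + γ (n+1) • P n := by
          rw [hPrec, smul_eq_C_mul, smul_eq_C_mul]; ring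
        rw [this]
        exact Submodule.add_mem _ (Submodule.add_mem _ (hm _) (Submodule.smul_mem _ _ (hm _)))
          (Submodule.smul_mem _ _ (hm _))
    | zero => simp
    | add x y _ _ hx hy => rw [mul_add]; exact Submodule.add_mem _ hx hy
    | smul a x _ hx => rw [mul_smul_comm]; exact Submodule.smul_mem _ _ hx
  have hX : ∀ n : ℕ, (X ^ n : ℂ[X]) ∈ Submodule.span ℂ (Set.range P) := by
    intro n
    induction n with
    | zero => rw [pow_zero, ← hP0]; exact Submodule.subset_span ⟨0, rfl⟩
    | succ n ih => rw [pow_succ']; exact key _ ih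
  have hall : ∀ f ∈ Submodule.span ℂ (Set.range P), v f = w f := by
    intro f hf
    induction hf using Submodule.span_induction with
    | mem x hx => obtain ⟨n, rfl⟩ := hx; exact h n
    | zero => simp
    | add x y _ _ hx hy => rw [map_add, map_add, hx, hy]
    | smul a x _ hx => rw [map_smul, map_smul, hx]
  refine LinearMap.ext fun f => hall f ?_
  rw [f.as_sum_range_C_mul_X_pow]
  refine Submodule.sum_mem _ fun i _ => ?_
  rw [← smul_eq_C_mul]
  exact Submodule.smul_mem _ _ (hX i)

/-- for `J = a_0^{[1]}D + (a_2/2)D²` a lowering operator of order one,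
with `a_2(x) = a_0^{[2]} + a_1^{[2]}x`, acting on a MOPS by `J(P_{n+1}) = λ_{n+1}^{[1]} P_n`,
the form `u_0` satisfies
`D(a_2 u_0) + ((λ_1^{[1]}/γ_1)(x−β_0)² − (λ_2^{[1]}/γ_2)P_2(x) − a_0^{[1]}) u_0 = 0`,
where `λ_1^{[1]} = a_0^{[1]}` and `λ_2^{[1]} = a_1^{[2]} + 2a_0^{[1]}`. -/
theorem lowering_order_one_functional_identity
    (c1 c02 c12 : ℂ)
    (hlam : ∀ n : ℕ, ((n : ℂ) + 1) * c1 + ((n : ℂ) * ((n : ℂ) + 1) / 2) * c12 ≠ 0)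
    (β γ : ℕ → ℂ) (P : ℕ → ℂ[X])
    (hP0 : P 0 = 1) (hP1 : P 1 = X - C (β 0))
    (hPrec : ∀ n : ℕ, P (n + 2) = (X - C (β (n + 1))) * P (n + 1) - C (γ (n + 1)) * P n)
    (hγ : ∀ n : ℕ, γ (n + 1) ≠ 0)
    (u : ℕ → Module.Dual ℂ ℂ[X])
    (hu : ∀ n m : ℕ, u n (P m) = if n = m then 1 else 0)
    (hJ : ∀ n : ℕ,
      C c1 * derivative (P (n + 1)) +
        (2 : ℂ)⁻¹ • ((C c02 + C c12 * X) * derivative (derivative (P (n + 1)))) =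
      (((n : ℂ) + 1) * c1 + ((n : ℂ) * ((n : ℂ) + 1) / 2) * c12) • P n) :
    derD (lmulD (C c02 + C c12 * X) (u 0)) +
      lmulD (C (c1 / γ 1) * (X - C (β 0)) ^ 2 - C ((c12 + 2 * c1) / γ 2) * P 2 - C c1)
        (u 0) = 0 := by
  have ext := dual_ext_of_rec β γ P hP0 hP1 hPrec
  have hX0 : ∀ b : ℂ, (X - C b) * P 0 = P 1 + (β 0 - b) • P 0 := by
    intro b
    rw [hP0, hP1, smul_eq_C_mul, C_sub]; ring
  have hXs : ∀ (b : ℂ) (n : ℕ), (X - C b) * P (n+1) =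
      P (n+2) + (β (n+1) - b) • P (n+1) + γ (n+1) • P n := by
    intro b n
    rw [hPrec, smul_eq_C_mul, smul_eq_C_mul, C_sub]; ring
  have h1 : ∀ f, γ 1 * u 1 f = u 0 (P 1 * f) := by
    have : γ 1 • u 1 = lmulD (P 1) (u 0) := by
      apply ext
      intro n
      simp only [lmulD, LinearMap.smul_apply, LinearMap.comp_apply, LinearMap.mulLeft_apply]
      rw [hP1]
      cases n with
      | zero => rw [hX0]; simp [hu]
      | succ n =>
        rw [hXs]
        rcases n with _ | n <;> simp [hu]
    intro f
    simpa [lmulD] using LinearMap.congr_fun this f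
  have h2' : ∀ f, γ 2 * u 2 f = u 1 ((X - C (β 1)) * f) - u 0 f := by
    have : γ 2 • u 2 = lmulD (X - C (β 1)) (u 1) - u 0 := by
      apply ext
      intro n
      simp only [lmulD, LinearMap.smul_apply, LinearMap.comp_apply, LinearMap.mulLeft_apply,
        LinearMap.sub_apply]
      rcases n with _ | _ | _ | n
      · rw [hX0]; simp [hu]
      all_goals rw [hXs]; simp [hu]
    intro f
    have := LinearMap.congr_fun this f
    simpa only [lmulD, LinearMap.smul_apply, LinearMap.comp_apply, LinearMap.mulLeft_apply,
        LinearMap.sub_apply, smul_eq_mul] using this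
  have h2 : ∀ f, γ 1 * γ 2 * u 2 f = u 0 (P 2 * f) := by
    intro f
    have e : P 2 * f = P 1 * ((X - C (β 1)) * f) - γ 1 • f := by
      rw [hPrec 0, hP0, smul_eq_C_mul]; ring
    rw [e, map_sub, map_smul, ← h1, smul_eq_mul, mul_assoc, h2']
    ring
  let J : ℂ[X] →ₗ[ℂ] ℂ[X] := LinearMap.mulLeft ℂ (C c1) ∘ₗ derivative +
    (2 : ℂ)⁻¹ • (LinearMap.mulLeft ℂ (C c02 + C c12 * X) ∘ₗ derivative ∘ₗ derivative)
  have hJa : ∀ f, J f = C c1 * derivative f +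
      (2 : ℂ)⁻¹ • ((C c02 + C c12 * X) * derivative (derivative f)) := fun f => rfl
  have hJP : ∀ n, J (P (n+1)) =
      (((n : ℂ) + 1) * c1 + ((n : ℂ) * ((n : ℂ) + 1) / 2) * c12) • P n := fun n => hJ n
  have hJ0 : J (P 0) = 0 := by rw [hJa, hP0]; simp
  have hJX : ∀ f, J (X * f) = X * J f + c1 • f + (C c02 + C c12 * X) * derivative f := by
    intro f
    have h2C : (C (2:ℂ)⁻¹ : ℂ[X]) * 2 = 1 := by
      rw [show (2 : ℂ[X]) = C 2 from rfl, ← C_mul]; simp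
    simp only [hJa, derivative_mul, derivative_X, derivative_one, map_add, smul_eq_C_mul]
    linear_combination ((C c02 + C c12 * X) * derivative f) * h2C
  have g0 : ∀ f, u 0 (J f) = c1 * u 1 f := by
    have : u 0 ∘ₗ J = c1 • u 1 := by
      apply ext
      intro n
      simp only [LinearMap.smul_apply, LinearMap.comp_apply]
      cases n with
      | zero => rw [hJ0]; simp [hu]
      | succ n => rw [hJP]; rcases n with _ | n <;> simp [hu]
    intro f
    simpa using LinearMap.congr_fun this f
  have g1 : ∀ f, u 1 (J f) = (c12 + 2 * c1) * u 2 f := by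
    have : u 1 ∘ₗ J = (c12 + 2 * c1) • u 2 := by
      apply ext
      intro n
      simp only [LinearMap.smul_apply, LinearMap.comp_apply]
      rcases n with _ | _ | _ | n
      · rw [hJ0]; simp [hu]
      · rw [hJP]; simp [hu]
      · rw [hJP]; simp [hu]; ring
      · rw [hJP]; simp [hu]
    intro f
    simpa using LinearMap.congr_fun this f
  have hg1 : γ 1 ≠ 0 := hγ 0
  have hg2 : γ 2 ≠ 0 := hγ 1
  refine LinearMap.ext fun f => ?_
  have eL : (derD (lmulD (C c02 + C c12 * X) (u 0)) +
      lmulD (C (c1 / γ 1) * (X - C (β 0)) ^ 2 - C ((c12 + 2 * c1) / γ 2) * P 2 - C c1)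
        (u 0)) f = - u 0 ((C c02 + C c12 * X) * derivative f) + 
        u 0 ((C (c1 / γ 1) * (X - C (β 0)) ^ 2 - C ((c12 + 2 * c1) / γ 2) * P 2 - C c1) * f) := rfl
  have e2 : (C (c1 / γ 1) * (X - C (β 0)) ^ 2 - C ((c12 + 2 * c1) / γ 2) * P 2 - C c1) * f =
      (c1 / γ 1) • (P 1 * (X * f)) - (c1 / γ 1 * β 0) • (P 1 * f)
        - ((c12 + 2 * c1) / γ 2) • (P 2 * f) - c1 • f := by
    simp only [smul_eq_C_mul, hP1, C_mul]; ring
  have e3 : (C c02 + C c12 * X) * derivative f = J (X * f) - P 1 * J f - β 0 • J f - c1 • f := by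
    rw [hJX, hP1, smul_eq_C_mul (β 0)]; ring
  rw [eL, e2, e3]
  simp only [map_sub, map_smul, smul_eq_mul, LinearMap.zero_apply]
  rw [← h1, ← h1, ← h1, ← h2, g0, g0, g1]
  field_simp
  ring
end

section
/- Let a_0^{[1]}, a_0^{[2]}, a_1^{[2]} ∈ ℂ, set a_2(x) = a_0^{[2]} + a_1^{[2]}x, let J = a_0^{[1]}D + (a_2(x)/2)D², and assume λ_{n+1}^{[1]} := (n+1)a_0^{[1]} + (n(n+1)/2)·a_1^{[2]} ≠ 0 for all n ≥ 0. Let (P_n)_{n≥0} be a monic orthogonal polynomial sequence with respect to u_0, with recurrence coefficients (β_n), (γ_{n+1}), and suppose J(P_{n+1}) = λ_{n+1}^{[1]}·P_n for every n ≥ 0. Then: (i) λ_1^{[1]}/γ_1 = λ_2^{[1]}/γ_2, equivalently a_1^{[2]} = a_0^{[1]}·(γ_2 − 2γ_1)/γ_1; and (ii) u_0 satisfies the classical-type functional equation D(a_2(x)·u_0) − (a_0^{[1]}/γ_1)·(β_0 − β_1)·(x − β_0)·u_0 = 0. -/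
open Polynomial

/-- the operator `J` as a linear map -/
noncomputable def opJ (c1 c02 c12 : ℂ) : ℂ[X] →ₗ[ℂ] ℂ[X] :=
  LinearMap.mulLeft ℂ (C c1) ∘ₗ derivative +
    (2 : ℂ)⁻¹ • (LinearMap.mulLeft ℂ (C c02 + C c12 * X) ∘ₗ derivative ∘ₗ derivative)

lemma opJ_apply (c1 c02 c12 : ℂ) (p : ℂ[X]) : opJ c1 c02 c12 p =
    C c1 * derivative p + (2 : ℂ)⁻¹ • ((C c02 + C c12 * X) * derivative (derivative p)) := by
  simp [opJ]

lemma opJ_mul (c1 c02 c12 b : ℂ) (p : ℂ[X]) : opJ c1 c02 c12 ((X - C b) * p) =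
    (X - C b) * opJ c1 c02 c12 p + C c1 * p + (C c02 + C c12 * X) * derivative p := by
  have h : (C (2:ℂ)⁻¹ : ℂ[X]) * 2 = 1 := by
    rw [show (2 : ℂ[X]) = C 2 from (map_ofNat C 2).symm, ← C_mul]; simp
  simp only [opJ_apply, smul_eq_C_mul, derivative_mul, derivative_sub, derivative_X, derivative_C,
    derivative_add, map_add, derivative_one, derivative_zero]
  linear_combination ((C c02 + C c12 * X) * derivative p) * h

lemma ext_on_P (β γ : ℕ → ℂ) (P : ℕ → ℂ[X])
    (hP0 : P 0 = 1) (hP1 : P 1 = X - C (β 0))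
    (hPrec : ∀ n : ℕ, P (n + 2) = (X - C (β (n + 1))) * P (n + 1) - C (γ (n + 1)) * P n)
    (f g : Module.Dual ℂ ℂ[X]) (h : ∀ n, f (P n) = g (P n)) (p : ℂ[X]) : f p = g p := by
  have hX : ∀ q ∈ Submodule.span ℂ (Set.range P), X * q ∈ Submodule.span ℂ (Set.range P) := by
    intro q hq
    induction hq using Submodule.span_induction with
    | mem x hx =>
      obtain ⟨n, rfl⟩ := hx
      have hm : ∀ k, P k ∈ Submodule.span ℂ (Set.range P) :=
        fun k => Submodule.subset_span ⟨k, rfl⟩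
      cases n with
      | zero =>
        have : X * P 0 = P 1 + (β 0) • P 0 := by rw [hP1, hP0, smul_eq_C_mul]; ring
        rw [this]
        exact add_mem (hm _) (Submodule.smul_mem _ _ (hm _))
      | succ n =>
        have : X * P (n+1) = P (n+2) + (β (n+1)) • P (n+1) + γ (n+1) • P n := by
          rw [hPrec, smul_eq_C_mul, smul_eq_C_mul]; ring
        rw [this]
        exact add_mem (add_mem (hm _) (Submodule.smul_mem _ _ (hm _)))
          (Submodule.smul_mem _ _ (hm _))
    | zero => simp
    | add x y _ _ hx hy => rw [mul_add]; exact add_mem hx hy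
    | smul a x _ hx => rw [mul_smul_comm]; exact Submodule.smul_mem _ _ hx
  have hmem : ∀ n : ℕ, (X ^ n : ℂ[X]) ∈ Submodule.span ℂ (Set.range P) := by
    intro n
    induction n with
    | zero => rw [pow_zero, ← hP0]; exact Submodule.subset_span ⟨0, rfl⟩
    | succ n ih => rw [pow_succ']; exact hX _ ih
  have hp : p ∈ Submodule.span ℂ (Set.range P) := by
    rw [p.as_sum_range_C_mul_X_pow]
    refine Submodule.sum_mem _ fun i _ => ?_
    rw [← smul_eq_C_mul]
    exact Submodule.smul_mem _ _ (hmem i)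
  induction hp using Submodule.span_induction with
  | mem x hx => obtain ⟨n, rfl⟩ := hx; exact h n
  | zero => simp
  | add x y _ _ hx hy => simp [hx, hy]
  | smul a x _ hx => simp [hx]

/-- coefficient comparison in `J(x³ + bx² + dx + f) = λ₃ (x² + bbx + dd)` -/
lemma coeff_three (c1 c02 c12 l b d f bb dd : ℂ)
    (h : opJ c1 c02 c12 (X^3 + C b * X^2 + C d * X + C f) = l • (X^2 + C bb * X + C dd)) :
    b * (2 * c1 + c12) + 3 * c02 = l * bb ∧ d * c1 + b * c02 = l * dd := by
  have e : opJ c1 c02 c12 (X^3 + C b * X^2 + C d * X + C f) =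
      C (3 * c1 + 3 * c12) * X^2 + C (b * (2 * c1 + c12) + 3 * c02) * X
        + C (d * c1 + b * c02) := by
    have h : (C (2:ℂ)⁻¹ : ℂ[X]) * 2 = 1 := by
      rw [show (2 : ℂ[X]) = C 2 from (map_ofNat C 2).symm, ← C_mul]; simp
    simp [opJ_apply, smul_eq_C_mul, map_ofNat] at h ⊢
    linear_combination ((C c02 + C c12 * X) * (3 * X + C b)) * h
  rw [e] at h
  have h0 := congrArg (fun q => coeff q 0) h
  have h1 := congrArg (fun q => coeff q 1) h
  simp only [coeff_add, coeff_smul, coeff_C_mul, coeff_X, coeff_C, coeff_X_pow, smul_eq_mul] at h0 h1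
  norm_num at h0 h1
  exact ⟨h1, h0⟩

lemma coeff_four (c1 c02 c12 l b d f g bb dd ff : ℂ)
    (h : opJ c1 c02 c12 (X^4 + C b * X^3 + C d * X^2 + C f * X + C g) =
      l • (X^3 + C bb * X^2 + C dd * X + C ff)) :
    b * (3 * c1 + 3 * c12) + 6 * c02 = l * bb ∧
      d * (2 * c1 + c12) + 3 * b * c02 = l * dd := by
  have e : opJ c1 c02 c12 (X^4 + C b * X^3 + C d * X^2 + C f * X + C g) =
      C (4 * c1 + 6 * c12) * X^3 + C (b * (3 * c1 + 3 * c12) + 6 * c02) * X^2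
        + C (d * (2 * c1 + c12) + 3 * b * c02) * X + C (f * c1 + d * c02) := by
    have h : (C (2:ℂ)⁻¹ : ℂ[X]) * 2 = 1 := by
      rw [show (2 : ℂ[X]) = C 2 from (map_ofNat C 2).symm, ← C_mul]; simp
    simp [opJ_apply, smul_eq_C_mul, map_ofNat] at h ⊢
    linear_combination ((C c02 + C c12 * X) * (6 * X^2 + 3 * C b * X + C d)) * h
  rw [e] at h
  have h0 := congrArg (fun q => coeff q 1) h
  have h1 := congrArg (fun q => coeff q 2) h
  simp only [coeff_add, coeff_smul, coeff_C_mul, coeff_X, coeff_C, coeff_X_pow, smul_eq_mul] at h0 h1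
  norm_num at h0 h1
  exact ⟨h1, h0⟩

/-- the quotients `γ_n / λ_n` are in arithmetic progression -/
lemma nu_arith (c1 c02 c12 b0 b1 b2 b3 g1 g2 g3 B3 D3 B4 D4 : ℂ)
    (hl1 : c1 ≠ 0) (hl2 : 2 * c1 + c12 ≠ 0) (hl3 : 3 * c1 + 3 * c12 ≠ 0)
    (hB3 : B3 = -b0 - b1 - b2) (hD3 : D3 = (b0 * b1 - g1) + b2 * (b0 + b1) - g2)
    (hB4 : B4 = B3 - b3) (hD4 : D4 = D3 - b3 * B3 - g3)
    (e1 : c1 * (b1 - b0) = c02 + c12 * b0)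
    (e2 : B3 * (2 * c1 + c12) + 3 * c02 = (3 * c1 + 3 * c12) * (-b0 - b1))
    (e3 : D3 * c1 + B3 * c02 = (3 * c1 + 3 * c12) * (b0 * b1 - g1))
    (e4 : B4 * (3 * c1 + 3 * c12) + 6 * c02 = (4 * c1 + 6 * c12) * B3)
    (e5 : D4 * (2 * c1 + c12) + 3 * B4 * c02 = (4 * c1 + 6 * c12) * D3) :
    g1 / c1 + g3 / (3 * c1 + 3 * c12) = 2 * (g2 / (2 * c1 + c12)) := by
  have hl3' : c1 + c12 ≠ 0 := by
    intro h; apply hl3; linear_combination 3 * h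
  have f1 : c02 = c1 * (b1 - b0) - c12 * b0 := by linear_combination -e1
  subst f1
  have f2 : b2 = 2 * b1 - b0 := by
    apply mul_right_cancel₀ hl2
    rw [hB3] at e2
    linear_combination -e2
  subst f2
  have f3 : b3 = 3 * b1 - 2 * b0 := by
    apply mul_right_cancel₀ hl3'
    rw [hB4, hB3] at e4
    linear_combination -e4 / 3
  subst f3
  subst hB4 hD4 hB3 hD3
  have g2e : g2 = ((b0 * b1 - g1) + (2 * b1 - b0) * (b0 + b1)) -
      ((3 * c1 + 3 * c12) * (b0 * b1 - g1) -
       (-b0 - b1 - (2 * b1 - b0)) * (c1 * (b1 - b0) - c12 * b0)) / c1 := by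
    field_simp
    linear_combination -e3
  field_simp
  subst g2e
  field_simp at e5 ⊢
  linear_combination -e5

/-- for `J = a_0^{[1]}D + (a_2/2)D²` a lowering operator of order one acting on a
MOPS by `J(P_{n+1}) = λ_{n+1}^{[1]} P_n`: (i) `λ_1^{[1]}/γ_1 = λ_2^{[1]}/γ_2`, equivalently
`a_1^{[2]} = a_0^{[1]}(γ_2 − 2γ_1)/γ_1`; and (ii)
`D(a_2 u_0) − (a_0^{[1]}/γ_1)(β_0 − β_1)(x − β_0) u_0 = 0`. -/
theorem lowering_order_one_Laguerre_identity
    (c1 c02 c12 : ℂ)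
    (hlam : ∀ n : ℕ, ((n : ℂ) + 1) * c1 + ((n : ℂ) * ((n : ℂ) + 1) / 2) * c12 ≠ 0)
    (β γ : ℕ → ℂ) (P : ℕ → ℂ[X])
    (hP0 : P 0 = 1) (hP1 : P 1 = X - C (β 0))
    (hPrec : ∀ n : ℕ, P (n + 2) = (X - C (β (n + 1))) * P (n + 1) - C (γ (n + 1)) * P n)
    (hγ : ∀ n : ℕ, γ (n + 1) ≠ 0)
    (u : ℕ → Module.Dual ℂ ℂ[X])
    (hu : ∀ n m : ℕ, u n (P m) = if n = m then 1 else 0)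
    (hJ : ∀ n : ℕ,
      C c1 * derivative (P (n + 1)) +
        (2 : ℂ)⁻¹ • ((C c02 + C c12 * X) * derivative (derivative (P (n + 1)))) =
      (((n : ℂ) + 1) * c1 + ((n : ℂ) * ((n : ℂ) + 1) / 2) * c12) • P n) :
    (c1 / γ 1 = (c12 + 2 * c1) / γ 2 ∧ c12 = c1 * (γ 2 - 2 * γ 1) / γ 1) ∧
    derD (lmulD (C c02 + C c12 * X) (u 0)) -
      lmulD (C (c1 / γ 1 * (β 0 - β 1)) * (X - C (β 0))) (u 0) = 0 := by
  have hl1 : c1 ≠ 0 := by simpa using hlam 0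
  have hl2 : 2 * c1 + c12 ≠ 0 := by
    have := hlam 1; intro h; apply this; push_cast; linear_combination h
  have hl3 : 3 * c1 + 3 * c12 ≠ 0 := by
    have := hlam 2; intro h; apply this; push_cast; linear_combination h
  have hg1 := hγ 0
  have hg2 := hγ 1
  have hg3 := hγ 2
  simp only [zero_add] at hg1
  norm_num at hg2 hg3
  have hext := ext_on_P β γ P hP0 hP1 hPrec
  simp only [← opJ_apply] at hJ
  have hJ0 : opJ c1 c02 c12 (P 0) = 0 := by simp [opJ_apply, hP0]
  have hu0 : ∀ m, u 0 (P m) = if m = 0 then 1 else 0 := by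
    intro m; rw [hu]; simp [eq_comm]
  -- multiplication by `X - b`
  have hmul0 : ∀ b : ℂ, (X - C b) * P 0 = P 1 + (β 0 - b) • P 0 := by
    intro b; rw [hP1, hP0, smul_eq_C_mul, C_sub]; ring
  have hmulS : ∀ (b : ℂ) n, (X - C b) * P (n+1) =
      P (n+2) + (β (n+1) - b) • P (n+1) + γ (n+1) • P n := by
    intro b n; rw [hPrec, smul_eq_C_mul, smul_eq_C_mul, C_sub]; ring
  have h1 : ∀ m, u 0 (P 1 * P m) = if m = 1 then γ 1 else 0 := by
    intro m
    rw [hP1]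
    rcases m with _ | _ | n
    · rw [hmul0]; simp [hu0]
    · rw [hmulS]; simp [hu0]
    · rw [hmulS]; simp [hu0]
  have hP2 : P 2 = (X - C (β 1)) * P 1 - C (γ 1) * P 0 := hPrec 0
  have h2 : ∀ m, u 0 (P 2 * P m) = if m = 2 then γ 1 * γ 2 else 0 := by
    intro m
    have e : P 2 * P m = P 1 * ((X - C (β 1)) * P m) - γ 1 • P m := by
      rw [hP2, hP0, smul_eq_C_mul]; ring
    rw [e]
    rcases m with _ | _ | _ | n
    · rw [hmul0]; simp [hu0, h1, mul_add]
    · rw [hmulS]; simp [hu0, h1, mul_add]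
    · rw [hmulS]; simp [hu0, h1, mul_add]; ring
    · rw [hmulS]; simp [hu0, h1, mul_add]
  have hA : ∀ p, u 0 (opJ c1 c02 c12 p) = c1 / γ 1 * u 0 (P 1 * p) := by
    refine hext (u 0 ∘ₗ opJ c1 c02 c12) ((c1 / γ 1) • (u 0 ∘ₗ LinearMap.mulLeft ℂ (P 1))) ?_
    intro n
    rcases n with _ | _ | n
    · simp [hJ0, h1]
    · simp [hJ, hu0, h1]; field_simp
    · simp [hJ, hu0, h1]
  have hB : ∀ p, u 0 (P 1 * opJ c1 c02 c12 p) = (2 * c1 + c12) / γ 2 * u 0 (P 2 * p) := by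
    refine hext (u 0 ∘ₗ LinearMap.mulLeft ℂ (P 1) ∘ₗ opJ c1 c02 c12)
      (((2 * c1 + c12) / γ 2) • (u 0 ∘ₗ LinearMap.mulLeft ℂ (P 2))) ?_
    intro n
    rcases n with _ | _ | _ | n
    · simp [hJ0, h2]
    · simp [hJ, h1, h2]
    · simp [hJ, h1, h2]; field_simp; ring
    · simp [hJ, h1, h2]
  -- the reciprocals
  have hmu : c1 / γ 1 - 2 * ((2 * c1 + c12) / γ 2) + (3 * c1 + 3 * c12) / γ 3 = 0 := by
    have k1 : u 0 (P 2 * (P 1 * P 3)) = γ 1 * γ 2 * γ 3 := by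
      rw [hP1, hmulS]; simp [mul_add, h2]; ring
    have k2 : u 0 (P 1 * (P 1 * P 2)) = γ 1 * γ 2 := by
      nth_rw 2 [hP1]; rw [hmulS]; simp [mul_add, h1]; ring
    have k3 : u 0 (P 1 * (P 1 * (P 1 * P 3))) = γ 1 * γ 2 * γ 3 := by
      have : P 1 * (P 1 * (P 1 * P 3)) = P 2 * (P 1 * P 3)
          + (β 1 - β 0) • (P 1 * (P 1 * P 3)) + γ 1 • (P 1 * P 3) := by
        rw [hP2, hP0, smul_eq_C_mul, smul_eq_C_mul, hP1, C_sub]; ring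
      rw [this, map_add, map_add, k1]
      have : u 0 (P 1 * (P 1 * P 3)) = 0 := by
        nth_rw 2 [hP1]; rw [hmulS]; simp [mul_add, h1]
      simp [this, h1]
    have k4 : u 0 ((C c02 + C c12 * X) * P 3) = 0 := by
      have : (C c02 + C c12 * X) * P 3 = c12 • (P 1 * P 3) + (c02 + c12 * β 0) • P 3 := by
        rw [hP1]; simp only [smul_eq_C_mul, C_add, C_mul]; ring
      rw [this]; simp [h1, hu0]
    have k5 : opJ c1 c02 c12 (P 1 * (P 1 * P 3)) - (2:ℂ) • (P 1 * opJ c1 c02 c12 (P 1 * P 3))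
        + P 1 * (P 1 * opJ c1 c02 c12 (P 3)) = (C c02 + C c12 * X) * P 3 := by
      rw [hP1, opJ_mul, opJ_mul, smul_eq_C_mul]
      simp only [derivative_mul, derivative_sub, derivative_X, derivative_C, map_ofNat]
      ring
    have k6 := congrArg (u 0) k5
    rw [k4, map_add, map_sub, map_smul, hA, hB, k3, k1, hJ 2] at k6
    simp only [mul_smul_comm, map_smul, k2, smul_eq_mul] at k6
    field_simp
    field_simp at k6
    push_cast at k6
    linear_combination k6 / 2
  have hnu : γ 1 / c1 + γ 3 / (3 * c1 + 3 * c12) = 2 * (γ 2 / (2 * c1 + c12)) := by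
    have p2 : P 2 = X^2 + C (-β 0 - β 1) * X + C (β 0 * β 1 - γ 1) := by
      rw [hP2, hP1, hP0]; simp only [C_sub, C_neg, C_mul]; ring
    obtain ⟨B3, hB3⟩ : ∃ B3, B3 = -β 0 - β 1 - β 2 := ⟨_, rfl⟩
    obtain ⟨D3, hD3⟩ : ∃ D3, D3 = (β 0 * β 1 - γ 1) + β 2 * (β 0 + β 1) - γ 2 := ⟨_, rfl⟩
    obtain ⟨F3, hF3⟩ : ∃ F3, F3 = -β 2 * (β 0 * β 1 - γ 1) + γ 2 * β 0 := ⟨_, rfl⟩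
    have p3 : P 3 = X^3 + C B3 * X^2 + C D3 * X + C F3 := by
      rw [hPrec 1, p2, hP1, hB3, hD3, hF3]
      simp only [C_sub, C_neg, C_mul, C_add, Nat.reduceAdd]; ring
    have p4 : P 4 = X^4 + C (B3 - β 3) * X^3 + C (D3 - β 3 * B3 - γ 3) * X^2
        + C (F3 - β 3 * D3 - γ 3 * (-β 0 - β 1)) * X
        + C (-β 3 * F3 - γ 3 * (β 0 * β 1 - γ 1)) := by
      rw [hPrec 2, p3, p2]
      simp only [C_sub, C_neg, C_mul, C_add, Nat.reduceAdd]; ring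
    have j3 := hJ 2
    have j4 := hJ 3
    norm_num only [Nat.reduceAdd] at j3 j4
    rw [p3, p2] at j3
    rw [p4, p3] at j4
    obtain ⟨e2, e3⟩ := coeff_three _ _ _ _ _ _ _ _ _ j3
    obtain ⟨e4, e5⟩ := coeff_four _ _ _ _ _ _ _ _ _ _ _ j4
    have e1 : c1 * (β 1 - β 0) = c02 + c12 * β 0 := by
      -- apply the functional to `J (P₁ P₁)`
      have a1 := hA (P 1 * P 1)
      have a2 : opJ c1 c02 c12 (P 1 * P 1) = (2 * c1 + c12) • P 1 + (c02 + c12 * β 0) • P 0 := by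
        nth_rw 1 [hP1]
        rw [opJ_mul, hJ 0, hP0, hP1]
        simp [smul_eq_C_mul]
        rw [show (C 2 : ℂ[X]) = 2 from map_ofNat C 2]; ring
      have a3 : u 0 (P 1 * (P 1 * P 1)) = γ 1 * (β 1 - β 0) := by
        nth_rw 2 [hP1]; rw [hmulS]; simp [mul_add, h1]; ring
      rw [a2, a3] at a1
      simp [hu0] at a1
      rw [a1]; field_simp
    refine nu_arith c1 c02 c12 (β 0) (β 1) (β 2) (β 3) _ _ _ B3 D3 _ _ hl1 hl2 hl3 hB3 hD3 rfl rfl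
      e1 ?_ ?_ ?_ ?_
    · linear_combination e2
    · linear_combination e3
    · linear_combination e4
    · linear_combination e5
  have key : c1 / γ 1 = (2 * c1 + c12) / γ 2 := by
    obtain ⟨x, hx⟩ : ∃ x, x = γ 1 / c1 := ⟨_, rfl⟩
    obtain ⟨y, hy⟩ : ∃ y, y = γ 2 / (2 * c1 + c12) := ⟨_, rfl⟩
    obtain ⟨z, hz⟩ : ∃ z, z = γ 3 / (3 * c1 + 3 * c12) := ⟨_, rfl⟩
    have hx0 : x ≠ 0 := hx ▸ div_ne_zero hg1 hl1
    have hy0 : y ≠ 0 := hy ▸ div_ne_zero hg2 hl2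
    have hz0 : z ≠ 0 := hz ▸ div_ne_zero hg3 hl3
    have ix : c1 / γ 1 = x⁻¹ := by rw [hx, inv_div]
    have iy : (2 * c1 + c12) / γ 2 = y⁻¹ := by rw [hy, inv_div]
    have iz : (3 * c1 + 3 * c12) / γ 3 = z⁻¹ := by rw [hz, inv_div]
    rw [ix, iy, iz] at hmu
    rw [← hx, ← hy, ← hz] at hnu
    rw [ix, iy]
    have hz' : z = 2 * y - x := by linear_combination hnu
    have q : y * z - 2 * (x * z) + x * y = 0 := by
      field_simp at hmu
      linear_combination hmu
    rw [hz'] at q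
    have : (x - y) ^ 2 = 0 := by linear_combination q / 2
    have : x = y := sub_eq_zero.mp (pow_eq_zero_iff (two_ne_zero) |>.mp this)
    rw [this]
  refine ⟨⟨by rw [key, add_comm], ?_⟩, ?_⟩
  · field_simp at key ⊢
    linear_combination -key
  · apply LinearMap.ext
    intro p
    have a1 := hA (P 1 * p)
    have a2 := hB p
    have a3 : opJ c1 c02 c12 (P 1 * p) = P 1 * opJ c1 c02 c12 p + c1 • p
        + (C c02 + C c12 * X) * derivative p := by
      rw [hP1, opJ_mul, smul_eq_C_mul]
    have a4 : P 2 * p = P 1 * (P 1 * p) - (β 1 - β 0) • (P 1 * p) - γ 1 • p := by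
      rw [hP2, hP0, smul_eq_C_mul, smul_eq_C_mul, hP1, C_sub]; ring
    rw [a3, map_add, map_add, a2, a4, ← key] at a1
    simp only [map_sub, map_smul, smul_eq_mul] at a1
    have a5 : C (c1 / γ 1 * (β 0 - β 1)) * (X - C (β 0)) * p
        = (c1 / γ 1 * (β 0 - β 1)) • (P 1 * p) := by
      rw [hP1, smul_eq_C_mul]; ring
    simp only [derD, lmulD, LinearMap.sub_apply, LinearMap.neg_apply, LinearMap.comp_apply,
      LinearMap.mulLeft_apply, LinearMap.zero_apply, a5, map_smul, smul_eq_mul]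
    have a6 : c1 / γ 1 * γ 1 = c1 := by field_simp
    linear_combination -a1 - (u 0 p) * a6
end

section
/- Let a_0^{[2]} ∈ ℂ with a_0^{[2]} ≠ 0 and let J = (a_0^{[2]}/2)·D², so that λ_{n+2}^{[2]} := ((n+1)(n+2)/2)·a_0^{[2]} ≠ 0 for all n ≥ 0. Let (P_n)_{n≥0} be a monic orthogonal polynomial sequence with respect to u_0, with recurrence coefficients (β_n), (γ_{n+1}), and suppose J(P_{n+2}) = λ_{n+2}^{[2]}·P_n for every n ≥ 0. Define ψ(x) = a_0^{[2]}·(x−β_0)·(γ_1γ_2)^{-1}·P_2(x) − 3a_0^{[2]}·(γ_2γ_3)^{-1}·P_3(x). Then: (i) u_0 satisfies D(a_0^{[2]}·u_0) + ψ(x)·u_0 = 0; and (ii) the polynomial identity (2λ_2^{[2]}/(γ_1γ_2))·P_2(x) + ψ'(x) − ψ(x)²/a_0^{[2]} = 0 holds, where λ_2^{[2]} = a_0^{[2]}. -/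
open Polynomial

/-- for `J = (a_0^{[2]}/2)D²` a lowering operator of order two acting on a MOPS
by `J(P_{n+2}) = λ_{n+2}^{[2]} P_n`, with
`ψ(x) = a_0^{[2]}(x−β_0)(γ_1γ_2)⁻¹P_2(x) − 3a_0^{[2]}(γ_2γ_3)⁻¹P_3(x)`:
(i) `D(a_0^{[2]} u_0) + ψ u_0 = 0`; and
(ii) `(2λ_2^{[2]}/(γ_1γ_2))P_2 + ψ' − ψ²/a_0^{[2]} = 0` with `λ_2^{[2]} = a_0^{[2]}`. -/
theorem lowering_order_two_Hermite_identity
    (c : ℂ) (hc : c ≠ 0)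
    (β γ : ℕ → ℂ) (P : ℕ → ℂ[X])
    (hP0 : P 0 = 1) (hP1 : P 1 = X - C (β 0))
    (hPrec : ∀ n : ℕ, P (n + 2) = (X - C (β (n + 1))) * P (n + 1) - C (γ (n + 1)) * P n)
    (hγ : ∀ n : ℕ, γ (n + 1) ≠ 0)
    (u : ℕ → Module.Dual ℂ ℂ[X])
    (hu : ∀ n m : ℕ, u n (P m) = if n = m then 1 else 0)
    (hJ : ∀ n : ℕ, (c / 2) • derivative (derivative (P (n + 2))) =
      (((n : ℂ) + 1) * ((n : ℂ) + 2) / 2 * c) • P n)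
    (ψ : ℂ[X])
    (hψ : ψ = C c * (X - C (β 0)) * (C (γ 1 * γ 2)⁻¹ * P 2) -
      C (3 * c) * (C (γ 2 * γ 3)⁻¹ * P 3)) :
    derD (lmulD (C c) (u 0)) + lmulD ψ (u 0) = 0 ∧
    C (2 * c / (γ 1 * γ 2)) * P 2 + derivative ψ - C c⁻¹ * ψ ^ 2 = 0 := by
  have huC : ∀ (k : ℕ) (a : ℂ) (p : ℂ[X]), u k (C a * p) = a * u k p := by
    intro k a p
    rw [← smul_eq_C_mul, map_smul, smul_eq_mul]
  have huA : ∀ (k : ℕ) (p q : ℂ[X]), u k (p + q) = u k p + u k q := fun k p q => map_add _ p q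
  have huS : ∀ (k : ℕ) (p q : ℂ[X]), u k (p - q) = u k p - u k q := fun k p q => map_sub _ p q
  have hJ' : ∀ n : ℕ, derivative (derivative (P (n + 2))) =
      C (((n : ℂ) + 1) * ((n : ℂ) + 2)) * P n := by
    intro n
    have h := congrArg (fun p => (2 / c) • p) (hJ n)
    simp only [smul_smul] at h
    rw [show 2 / c * (c / 2) = 1 by field_simp, one_smul, smul_eq_C_mul] at h
    rw [h]
    congr 2
    field_simp
  have hX : ∀ n : ℕ, X * P (n + 1) =
      P (n + 2) + C (β (n + 1)) * P (n + 1) + C (γ (n + 1)) * P n := by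
    intro n
    rw [hPrec n]; ring
  have hX0 : X * P 0 = P 1 + C (β 0) * P 0 := by
    rw [hP1, hP0]; ring
  have hd1 : derivative (P 1) = P 0 := by rw [hP1, hP0]; simp
  -- second derivative of the recurrence
  have hdd : ∀ n : ℕ, derivative (derivative (P (n + 2))) =
      2 * derivative (P (n + 1)) + (X - C (β (n + 1))) * derivative (derivative (P (n + 1)))
        - C (γ (n + 1)) * derivative (derivative (P n)) := by
    intro n
    rw [hPrec n]
    simp only [derivative_sub, derivative_mul, derivative_C, derivative_X, derivative_add]
    simp
    ring
  have hd : ∀ n : ℕ, derivative (P (n + 2)) =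
      (X - C (β (n + 1))) * derivative (P (n + 1)) + P (n + 1)
        - C (γ (n + 1)) * derivative (P n) := by
    intro n
    rw [hPrec n]
    simp only [derivative_sub, derivative_mul, derivative_C, derivative_X]
    ring
  have two_ne : (2 : ℂ[X]) ≠ 0 := two_ne_zero
  obtain ⟨b, hb⟩ : ∃ b : ℂ, derivative (P 2) = C 2 * P 1 + C b * P 0 := by
    refine ⟨β 0 - β 1, ?_⟩
    have h := hd 0
    simp only [zero_add] at h
    rw [h, hd1, hP0, hP1]
    simp only [map_sub, derivative_one, map_ofNat]
    ring
  have hBD : ∀ n : ℕ, ∃ B D : ℂ, derivative (P (n + 3)) =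
      C ((n : ℂ) + 3) * P (n + 2) + C B * P (n + 1) + C D * P n := by
    intro n
    have h := hdd (n + 2)
    have h1 := hJ' (n + 2)
    have h2 := hJ' (n + 1)
    have h3 := hJ' n
    have h4 := hX n
    rw [show n + 2 + 2 = n + 4 by ring] at h h1
    rw [show n + 2 + 1 = n + 3 by ring] at h
    rw [show n + 1 + 2 = n + 3 by ring] at h2
    rw [h1, h2, h3] at h
    refine ⟨-(((n : ℂ) + 2) * (n + 3) * (β (n + 1) - β (n + 3))) / 2,
      (γ (n + 3) * ((n + 1) * (n + 2)) - (n + 2) * (n + 3) * γ (n + 1)) / 2, ?_⟩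
    apply mul_left_cancel₀ two_ne
    have e1 : (2 : ℂ[X]) * C (-(((n : ℂ) + 2) * (n + 3) * (β (n + 1) - β (n + 3))) / 2)
        = C (-(((n : ℂ) + 2) * (n + 3) * (β (n + 1) - β (n + 3)))) := by
      rw [← map_ofNat C 2, ← C_mul]; congr 1; ring
    have e2 : (2 : ℂ[X]) * C ((γ (n + 3) * (((n : ℂ) + 1) * (n + 2))
          - (n + 2) * (n + 3) * γ (n + 1)) / 2)
        = C (γ (n + 3) * (((n : ℂ) + 1) * (n + 2)) - (n + 2) * (n + 3) * γ (n + 1)) := by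
      rw [← map_ofNat C 2, ← C_mul]; congr 1; ring
    have e3 : (2 : ℂ[X]) * derivative (P (n + 3)) = C (((n + 2 : ℕ) + 1 : ℂ) * (((n + 2 : ℕ) : ℂ) + 2)) * P (n + 2)
        - C (((n + 1 : ℕ) + 1 : ℂ) * (((n + 1 : ℕ) : ℂ) + 2)) * (X * P (n + 1) - C (β (n + 3)) * P (n + 1))
        + C (γ (n + 3)) * (C (((n : ℂ) + 1) * (n + 2)) * P n) := by
      rw [h]; ring
    have e4 : ∀ x y z p q r : ℂ[X], 2 * (x * p + y * q + z * r)
      = 2 * x * p + 2 * y * q + 2 * z * r := by intros; ring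
    rw [e3, h4, e4, e1, e2]
    simp only [map_mul, map_add, map_sub, map_neg, map_ofNat, Nat.cast_add, Nat.cast_ofNat,
      Nat.cast_one, map_one]
    ring
  choose B D hBD using hBD
  have hDγ : ∀ n : ℕ, D (n + 1) * γ (n + 1) = γ (n + 4) * D n := by
    intro n
    have h := hd (n + 3)
    rw [show n + 3 + 2 = (n + 2) + 3 by ring, show n + 3 + 1 = (n + 1) + 3 by ring, hBD, hBD,
      hBD] at h
    have h' := congrArg (u n) h
    have e : ∀ p q r : ℂ[X], ∀ x y z w : ℂ, (X - C w) * (C x * p + C y * q + C z * r)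
      = C x * (X * p) + C y * (X * q) + C z * (X * r)
        - (C w * (C x * p) + C w * (C y * q) + C w * (C z * r)) := by
      intros; ring
    rw [e, show n + 1 + 2 = (n + 1 + 1) + 1 by ring, hX (n + 1 + 1), hX (n + 1), hX n] at h'
    simp only [huA, huS, huC, hu] at h'
    simp [add_assoc] at h'
    linear_combination -h'
  have hD0 : D 0 = 0 := by
    have h := congrArg (u 0) (hJ' 4)
    rw [show 4 + 2 = 3 + 3 by ring, hBD] at h
    simp only [derivative_add, derivative_mul, derivative_C] at h
    rw [show 3 + 2 = 2 + 3 by ring, show 3 + 1 = 1 + 3 by ring, hBD, hBD,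
      show derivative (P 3) = _ from hBD 0] at h
    simp only [zero_mul, zero_add, huA, huC, hu] at h
    simp at h
    have h0 := hDγ 0
    have h1 := hDγ 1
    have h2 := hDγ 2
    rcases h with h | h
    · rw [h] at h2
      have : D 2 = 0 := by simpa [hγ] using h2.symm
      rw [this] at h1
      have : D 1 = 0 := by simpa [hγ] using h1.symm
      rw [this] at h0
      simpa [hγ] using h0.symm
    · exact h
  have hD : ∀ n, D n = 0 := by
    intro n
    induction n with
    | zero => exact hD0
    | succ n ih =>
      have h := hDγ n
      rw [ih] at h
      simpa [hγ] using h
  have hB' : ∀ n : ℕ, derivative (P (n + 3)) =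
      C ((n : ℂ) + 3) * P (n + 2) + C (B n) * P (n + 1) := by
    intro n
    rw [hBD, hD]; simp
  have hB3 : 3 * b + B 0 = 0 := by
    have h := congrArg (u 0) (hJ' 1)
    rw [show 1 + 2 = 0 + 3 by ring, hB'] at h
    simp only [derivative_add, derivative_mul, derivative_C, zero_add] at h
    rw [hb, hd1] at h
    simp only [zero_mul, zero_add, huA, huC, hu] at h
    simp at h
    linear_combination h
  have hB4 : 4 * B 0 + 2 * B 1 = 0 ∧ B 1 * b = 0 := by
    have h := hJ' 2
    rw [show 2 + 2 = 1 + 3 by ring, hB'] at h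
    simp only [derivative_add, derivative_mul, derivative_C] at h
    rw [show 1 + 2 = 0 + 3 by ring, hB', show 1 + 1 = 2 by ring, hb] at h
    have h0 := congrArg (u 0) h
    have h1 := congrArg (u 1) h
    simp only [zero_mul, zero_add, huA, huC, hu] at h0 h1
    norm_num at h0 h1
    constructor
    · linear_combination h1
    · simpa using h0
  have hb0 : b = 0 := by
    have : B 1 = 6 * b := by linear_combination hB4.1 / 2 - 2 * hB3
    have h := hB4.2
    rw [this] at h
    simpa using h
  have hBn : ∀ n, B n = 0 := by
    intro n
    induction n with
    | zero => rw [hb0] at hB3; simpa using hB3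
    | succ n ih =>
      have h := hJ' (n + 2)
      rw [show n + 2 + 2 = (n + 1) + 3 by ring, hB'] at h
      simp only [derivative_add, derivative_mul, derivative_C] at h
      rw [show n + 1 + 2 = n + 3 by ring, hB', ih, show n + 1 + 1 = n + 2 by ring] at h
      rcases n with _ | n
      · have h1 := hB4.1
        rw [ih] at h1
        simpa using h1
      · rw [show n + 1 + 2 = n + 3 by ring, hB'] at h
        have h1 := congrArg (u (n + 2)) h
        simp only [zero_mul, zero_add, huA, huC, hu] at h1
        simp at h1
        rcases h1 with h1 | h1
        · exact h1
        · exfalso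
          have : ((n + 3 : ℕ) : ℂ) = 0 := by push_cast; linear_combination h1
          exact absurd (Nat.cast_eq_zero.mp this) (by omega)
  have hA : ∀ n : ℕ, derivative (P (n + 1)) = C ((n : ℂ) + 1) * P n := by
    intro n
    rcases n with _ | _ | n
    · simp [hd1]
    · rw [show 0 + 1 + 1 = 2 by ring, hb, hb0]
      simp only [map_zero, zero_mul, add_zero, zero_add]
      norm_num
    · rw [show n + 1 + 1 + 1 = n + 3 by ring, hB', hBn]
      simp only [map_zero, zero_mul, add_zero]
      push_cast
      congr 2
      ring
  -- recurrence coefficients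
  have hr2 : β 1 = β 0 := by
    have h := hd 0
    rw [hA] at h
    simp only [zero_add] at h
    rw [hd1, hP0, hP1] at h
    have h1 := congrArg (eval 0) h
    simp at h1
    linear_combination h1
  have hp2 : P 2 = (X - C (β 0)) * (X - C (β 0)) - C (γ 1) := by
    rw [hPrec 0, hP0, zero_add, hP1, hr2, mul_one]
  have hr3 : γ 2 = 2 * γ 1 ∧ β 2 = β 0 := by
    have h := hd 1
    rw [hA, show 1 + 1 = 2 by ring, show derivative (P 2) = _ from hA 1, hd1, hP0, hp2, hP1] at h
    have h1 := congrArg (eval (β 0)) h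
    have h2 := congrArg (eval (β 0 + 1)) h
    simp at h1 h2
    have h3 : γ 2 = 2 * γ 1 := by linear_combination h1
    refine ⟨h3, ?_⟩
    linear_combination (h2 - h1) / 2
  have hg : γ 1 ≠ 0 := hγ 0
  have hp3 : P 3 = (X - C (β 0)) * ((X - C (β 0)) * (X - C (β 0)) - C (γ 1))
      - C (2 * γ 1) * (X - C (β 0)) := by
    rw [hPrec 1, show 1 + 1 = 2 by ring, hp2, hP1, hr3.1, hr3.2]
  have hr4 : γ 3 = 3 * γ 1 := by
    have h := hd 2
    rw [hA, show 2 + 1 = 3 by ring, show derivative (P 3) = _ from hA 2,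
      show derivative (P 2) = _ from hA 1, hp3, hp2, hP1] at h
    have h1 := congrArg (eval (β 0)) h
    have h2 := congrArg (eval (β 0 + 1)) h
    simp at h1 h2
    have h3 : β 3 = β 0 := by
      rcases h1 with h | h | h
      · linear_combination -h
      · norm_num at h
      · exact absurd h hg
    rw [h3] at h2
    linear_combination h2 / 2
  have hψ1 : ψ = C (c / γ 1) * P 1 := by
    rw [hψ, hp2, hp3, hP1, hr4, hr3.1]
    apply Polynomial.funext
    intro x
    simp only [eval_sub, eval_mul, eval_C, eval_X]
    field_simp
    ring
  constructor
  · have key : ∀ w : Module.Dual ℂ ℂ[X], (∀ m, w (P m) = 0) → w = 0 := by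
      intro w hw
      have h : ∀ k m, w (X ^ k * P m) = 0 := by
        intro k
        induction k with
        | zero => intro m; simpa using hw m
        | succ k ih =>
          intro m
          rw [pow_succ, mul_assoc]
          have e : ∀ (a : ℂ) (p q : ℂ[X]), p * (C a * q) = a • (p * q) := by
            intro a p q; rw [smul_eq_C_mul]; ring
          rcases m with _ | m
          · rw [hX0]; simp [mul_add, e, ih]
          · rw [hX]; simp [mul_add, e, ih]
      apply Polynomial.lhom_ext'
      intro k
      ext
      have := h k 0
      rw [hP0, mul_one] at this
      simpa [X_pow_eq_monomial] using this
    apply key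
    intro m
    simp only [derD, lmulD, LinearMap.add_apply, LinearMap.neg_apply, LinearMap.comp_apply,
      LinearMap.mulLeft_apply, huC]
    have h1 : C (c / γ 1) * P 1 * P m = C (c / γ 1) * (X * P m - C (β 0) * P m) := by
      rw [hP1]; ring
    rw [hψ1, h1, huC, huS, huC]
    rcases m with _ | m
    · have h0 : derivative (P 0) = 0 := by rw [hP0]; simp
      rw [hX0, h0]
      simp only [huA, huC, hu]
      simp
    · rw [hX, hA]
      simp only [huA, huC, hu]
      rcases m with _ | m
      · simp
        field_simp
        simp
      · simp
  · rw [hψ1, hp2, hr3.1, hP1]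
    apply Polynomial.funext
    intro x
    simp
    field_simp
    ring
end
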